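/- arXiv:1708.09306 — 5 statements merged into one kernel-verified Lean document; each statement's English description precedes it below -/
import Mathlib

section
/- Let n ≥ 2 be an integer, p ∈ (1, n) and β < n − p. Then the constant in the weighted Hardy inequality is sharp: the infimum, over all f ∈ C_c^∞(ℝ^n) with ∫_{ℝ^n} |f(x)|^p/|x|^{p+β} dx > 0, of the ratio (∫_{ℝ^n} |∂_r f(x)|^p/|x|^β dx) / (∫_{ℝ^n} |f(x)|^p/|x|^{p+β} dx) equals ((n−p−β)/p)^p. -/
open MeasureTheory

/-- The radial derivative `∂_r f (x) = ⟨x/|x|, ∇f(x)⟩` of `f : ℝⁿ → ℝ`. -/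
noncomputable def radDeriv {n : ℕ} (f : EuclideanSpace ℝ (Fin n) → ℝ)
    (x : EuclideanSpace ℝ (Fin n)) : ℝ :=
  fderiv ℝ f x (‖x‖⁻¹ • x)

lemma wh_young {p : ℝ} (hp : 1 < p) {c b : ℝ} (hc : 0 ≤ c) (hb : 0 ≤ b) :
    p * (c ^ (p - 1) * b) ≤ (p - 1) * c ^ p + b ^ p := by
  have hq : p.HolderConjugate (p / (p - 1)) := Real.HolderConjugate.conjExponent hp
  have h := Real.young_inequality_of_nonneg hb (Real.rpow_nonneg hc (p - 1)) hq
  have hp1 : p - 1 ≠ 0 := by linarith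
  have hp0 : p ≠ 0 := by linarith
  rw [← Real.rpow_mul hc, mul_div_cancel₀ _ hp1] at h
  have h2 := mul_le_mul_of_nonneg_left h (by linarith : (0:ℝ) ≤ p)
  have h3 : p * (b ^ p / p + c ^ p / (p / (p - 1))) = (p - 1) * c ^ p + b ^ p := by
    field_simp
    ring
  rw [h3] at h2
  linarith [mul_comm b (c ^ (p - 1))]

lemma wh_abs_rpow (p y : ℝ) (hp : 1 < p) : |y| ^ (p - 2) * |y| = |y| ^ (p - 1) := by
  rcases eq_or_ne y 0 with rfl | hy
  · simp [Real.zero_rpow (by linarith : p - 1 ≠ 0)]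
  · rw [← Real.rpow_add_one (abs_ne_zero.mpr hy)]
    congr 1
    ring

lemma wh_nontrivial (n : ℕ) (hn : 2 ≤ n) : Nontrivial (EuclideanSpace ℝ (Fin n)) := by
  have : Nonempty (Fin n) := ⟨⟨0, by omega⟩⟩
  infer_instance

/-- integrability of `1_{|x| ≤ R} |x|^{-s}`. -/
lemma wh_integrable_ball (n : ℕ) (hn : 2 ≤ n) (s : ℝ) (hs : s < n) (R : ℝ) :
    Integrable (fun x : EuclideanSpace ℝ (Fin n) =>
      (Set.Iic R).indicator (fun r : ℝ => (r ^ s)⁻¹) ‖x‖) := by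
  have := wh_nontrivial n hn
  rw [integrable_fun_norm_addHaar volume]
  have hd : Module.finrank ℝ (EuclideanSpace ℝ (Fin n)) = n := by simp
  rw [hd]
  have h1 : IntegrableOn (fun y : ℝ => y ^ ((n : ℝ) - 1 - s)) (Set.Ioc 0 (max R 0)) := by
    have := @intervalIntegral.intervalIntegrable_rpow' 0 (max R 0) ((n : ℝ) - 1 - s) (by linarith)
    rwa [intervalIntegrable_iff_integrableOn_Ioc_of_le (le_max_right _ _)] at this
  have h2 : IntegrableOn ((Set.Ioc 0 (max R 0)).indicator
      (fun y : ℝ => y ^ ((n : ℝ) - 1 - s))) (Set.Ioi 0) :=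
    (h1.integrable_indicator measurableSet_Ioc).integrableOn
  refine h2.congr_fun ?_ measurableSet_Ioi
  intro y hy
  have hy' : 0 < y := hy
  by_cases hR : y ≤ R
  · rw [Set.indicator_of_mem (show y ∈ Set.Ioc 0 (max R 0) from ⟨hy', hR.trans (le_max_left _ _)⟩)]
    simp only [smul_eq_mul]
    rw [Set.indicator_of_mem (show y ∈ Set.Iic R from hR), Real.rpow_sub hy', ← Real.rpow_natCast,
      Nat.cast_sub (by omega)]
    simp [div_eq_mul_inv]
  · have h3 : y ∉ Set.Ioc 0 (max R 0) := by
      rintro ⟨_, h⟩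
      rcases le_max_iff.mp h with h | h <;> linarith
    have h4 : y ∉ Set.Iic R := hR
    rw [Set.indicator_of_notMem h3]
    simp only [smul_eq_mul]
    rw [Set.indicator_of_notMem h4]
    simp

lemma wh_integrable (n : ℕ) (hn : 2 ≤ n) (s : ℝ) (hs : s < n) (R C : ℝ)
    (h : EuclideanSpace ℝ (Fin n) → ℝ) (hm : Measurable h) (hC : ∀ x, |h x| ≤ C)
    (hR : ∀ x, R < ‖x‖ → h x = 0) :
    Integrable (fun x => h x / ‖x‖ ^ s) := by
  refine ((wh_integrable_ball n hn s hs R).const_mul C).mono'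
    (by exact (hm.div (by fun_prop)).aestronglyMeasurable) (Filter.Eventually.of_forall fun x => ?_)
  by_cases hx : ‖x‖ ≤ R
  · rw [Set.indicator_of_mem (show ‖x‖ ∈ Set.Iic R from hx), norm_div, Real.norm_eq_abs,
      Real.norm_eq_abs, div_eq_mul_inv, abs_of_nonneg (Real.rpow_nonneg (norm_nonneg x) s)]
    exact mul_le_mul_of_nonneg_right (hC x) (inv_nonneg.mpr (Real.rpow_nonneg (norm_nonneg x) s))
  · rw [Set.indicator_of_notMem (show ‖x‖ ∉ Set.Iic R from hx), hR x (not_le.mp hx)]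
    simp

lemma wh_radDeriv_mul {n : ℕ} (f : EuclideanSpace ℝ (Fin n) → ℝ) (x : EuclideanSpace ℝ (Fin n)) :
    fderiv ℝ f x x = ‖x‖ * radDeriv f x := by
  unfold radDeriv
  rcases eq_or_ne x 0 with rfl | hx
  · simp
  · rw [map_smul, smul_eq_mul, ← mul_assoc, mul_inv_cancel₀ (norm_ne_zero_iff.mpr hx), one_mul]

theorem wh_hardy (n : ℕ) (hn : 2 ≤ n) (p β : ℝ) (hp1 : 1 < p) (hβ : β < n - p)
    (f : EuclideanSpace ℝ (Fin n) → ℝ) (hf : ContDiff ℝ (⊤ : ℕ∞) f) (hc : HasCompactSupport f) :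
    ((n - p - β) / p) ^ p * ∫ x : EuclideanSpace ℝ (Fin n), |f x| ^ p / ‖x‖ ^ (p + β) ≤
      ∫ x : EuclideanSpace ℝ (Fin n), |radDeriv f x| ^ p / ‖x‖ ^ β := by
  have := wh_nontrivial n hn
  set lam := (n - p - β) / p with hlam
  have hlam0 : 0 < lam := by
    apply div_pos <;> linarith
  have hp0 : 0 < p := by linarith
  set I := ∫ x : EuclideanSpace ℝ (Fin n), |f x| ^ p / ‖x‖ ^ (p + β) with hI
  set J := ∫ x : EuclideanSpace ℝ (Fin n), |radDeriv f x| ^ p / ‖x‖ ^ β with hJ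
  have hfc : Continuous f := hf.continuous
  have hdc : Continuous (fderiv ℝ f) := hf.continuous_fderiv (by simp)
  have hdiff : Differentiable ℝ f := hf.differentiable (by simp)
  obtain ⟨M, hM⟩ := hc.exists_bound_of_continuous hfc
  obtain ⟨D, hD⟩ := (hc.fderiv (𝕜 := ℝ)).exists_bound_of_continuous hdc
  have hM0 : 0 ≤ M := (norm_nonneg _).trans (hM 0)
  have hD0 : 0 ≤ D := (norm_nonneg _).trans (hD 0)
  obtain ⟨R, hR0, hR⟩ : ∃ R, 0 < R ∧ ∀ x, R < ‖x‖ → x ∉ tsupport f := by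
    obtain ⟨R, hR⟩ := hc.isBounded.exists_norm_le
    refine ⟨max R 1, by positivity, fun x hx h => ?_⟩
    have := hR x h
    linarith [le_max_left R 1]
  have hRf : ∀ x, R < ‖x‖ → f x = 0 := fun x hx => image_eq_zero_of_notMem_tsupport (hR x hx)
  have hRd : ∀ x, R < ‖x‖ → fderiv ℝ f x = 0 := fun x hx => by
    by_contra h
    exact hR x hx (support_fderiv_subset ℝ h)
  have hrad : ∀ x, |radDeriv f x| ≤ D := fun x => by
    unfold radDeriv
    refine ((fderiv ℝ f x).le_opNorm _).trans ?_
    refine (mul_le_mul (hD x) (?_ : _ ≤ (1:ℝ)) (norm_nonneg _) hD0).trans (by simp)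
    rw [norm_smul, norm_inv, norm_norm]
    exact inv_mul_le_one
  have hradm : Measurable (radDeriv f) := by
    unfold radDeriv
    have h1 : Measurable (fun x : EuclideanSpace ℝ (Fin n) => ‖x‖⁻¹ • x) := by fun_prop
    have h2 : Continuous (fun q : EuclideanSpace ℝ (Fin n) × EuclideanSpace ℝ (Fin n) =>
        fderiv ℝ f q.1 q.2) := by fun_prop
    exact h2.measurable.comp (measurable_id.prodMk h1)
  have hIint : Integrable (fun x : EuclideanSpace ℝ (Fin n) => |f x| ^ p / ‖x‖ ^ (p + β)) := by
    refine wh_integrable n hn (p + β) (by linarith) R (M ^ p) (fun x => |f x| ^ p)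
      (by have := hfc.measurable; fun_prop) (fun x => ?_) (fun x hx => ?_)
    · rw [abs_of_nonneg (by positivity)]
      exact Real.rpow_le_rpow (abs_nonneg _) (hM x) hp0.le
    · simp [hRf x hx, Real.zero_rpow hp0.ne']
  have hJint : Integrable (fun x : EuclideanSpace ℝ (Fin n) => |radDeriv f x| ^ p / ‖x‖ ^ β) := by
    refine wh_integrable n hn β (by linarith) R (D ^ p) (fun x => |radDeriv f x| ^ p)
      (by fun_prop) (fun x => ?_) (fun x hx => ?_)
    · rw [abs_of_nonneg (by positivity)]
      exact Real.rpow_le_rpow (abs_nonneg _) (hrad x) hp0.le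
    · simp [radDeriv, hRd x hx, Real.zero_rpow hp0.ne']
  -- scaling
  have hscale : ∀ t : ℝ, 0 < t →
      ∫ x : EuclideanSpace ℝ (Fin n), |f (t • x)| ^ p / ‖x‖ ^ (p + β) = t ^ (p + β - n) * I := by
    intro t ht
    have h1 := Measure.integral_comp_smul (volume : Measure (EuclideanSpace ℝ (Fin n)))
      (fun x => |f x| ^ p / ‖x‖ ^ (p + β)) t
    have h2 : ∀ x : EuclideanSpace ℝ (Fin n), |f (t • x)| ^ p / ‖x‖ ^ (p + β) =
        t ^ (p + β) * (|f (t • x)| ^ p / ‖t • x‖ ^ (p + β)) := fun x => by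
      rw [norm_smul, Real.norm_eq_abs, abs_of_pos ht, Real.mul_rpow ht.le (norm_nonneg _)]
      have : t ^ (p + β) ≠ 0 := (Real.rpow_pos_of_pos ht _).ne'
      rw [← mul_div_assoc, mul_div_mul_left _ _ this]
    simp_rw [h2]
    rw [integral_const_mul, h1, Real.rpow_sub ht]
    have hd : Module.finrank ℝ (EuclideanSpace ℝ (Fin n)) = n := by simp
    rw [hd, abs_of_pos (by positivity), Real.rpow_natCast, smul_eq_mul]
    rw [div_eq_mul_inv, mul_assoc]
  have hder1 : HasDerivAt (fun t : ℝ =>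
      ∫ x : EuclideanSpace ℝ (Fin n), |f (t • x)| ^ p / ‖x‖ ^ (p + β)) ((p + β - n) * I) 1 := by
    have h := ((Real.hasDerivAt_rpow_const (x := 1) (p := p + β - n)
      (Or.inl one_ne_zero))).mul_const I
    simp only [Real.one_rpow, mul_one] at h
    refine h.congr_of_eventuallyEq ?_
    filter_upwards [lt_mem_nhds (zero_lt_one (α := ℝ))] with t ht using hscale t ht
  -- differentiation under the integral
  have hder2 := hasDerivAt_integral_of_dominated_loc_of_deriv_le (𝕜 := ℝ)
    (μ := (volume : Measure (EuclideanSpace ℝ (Fin n))))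
    (bound := fun x => (p * M ^ (p - 1) * D * (2 * R)) *
      (Set.Iic (2 * R)).indicator (fun r : ℝ => (r ^ (p + β))⁻¹) ‖x‖)
    (F := fun t x => |f (t • x)| ^ p / ‖x‖ ^ (p + β))
    (F' := fun t x => (p * |f (t • x)| ^ (p - 2) * f (t • x)) * (fderiv ℝ f (t • x) x)
      / ‖x‖ ^ (p + β)) (x₀ := 1) (s := Set.Ioi (1 / 2)) (Ioi_mem_nhds (by norm_num))
    (Filter.Eventually.of_forall fun t => by
      have := hfc.measurable
      exact (Measurable.div (by fun_prop) (by fun_prop)).aestronglyMeasurable)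
    (by simpa using hIint)
    (by
      have := hfc.measurable
      have h2 : Measurable (fun x => fderiv ℝ f ((1:ℝ) • x) x) := by
        apply Continuous.measurable; fun_prop
      exact (Measurable.div (by fun_prop) (by fun_prop)).aestronglyMeasurable)
    (Filter.Eventually.of_forall fun x t ht => by
      have ht' : 1 / 2 < t := ht
      by_cases hx : ‖x‖ ≤ 2 * R
      · rw [Set.indicator_of_mem (show ‖x‖ ∈ Set.Iic (2 * R) from hx), div_eq_mul_inv, norm_mul,
          norm_inv, Real.norm_of_nonneg (Real.rpow_nonneg (norm_nonneg x) _)]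
        refine mul_le_mul_of_nonneg_right ?_ (inv_nonneg.mpr (Real.rpow_nonneg (norm_nonneg x) _))
        rw [norm_mul, norm_mul, norm_mul, Real.norm_of_nonneg hp0.le,
          Real.norm_of_nonneg (Real.rpow_nonneg (abs_nonneg _) _), mul_assoc p, Real.norm_eq_abs (f _),
          wh_abs_rpow _ _ hp1]
        have h1 : |f (t • x)| ^ (p - 1) ≤ M ^ (p - 1) :=
          Real.rpow_le_rpow (abs_nonneg _) (hM _) (by linarith)
        have h2 : ‖fderiv ℝ f (t • x) x‖ ≤ D * (2 * R) :=
          ((fderiv ℝ f (t • x)).le_opNorm x).trans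
            (mul_le_mul (hD _) hx (norm_nonneg _) hD0)
        rw [mul_assoc (p * M ^ (p - 1))]
        refine mul_le_mul (mul_le_mul_of_nonneg_left h1 hp0.le) h2 (norm_nonneg _) (by positivity)
      · have h1 : f (t • x) = 0 := hRf _ (by
          rw [norm_smul, Real.norm_of_nonneg (by linarith)]
          nlinarith [not_le.mp hx])
        rw [Set.indicator_of_notMem (show ‖x‖ ∉ Set.Iic (2 * R) from hx), h1]
        simp)
    ((wh_integrable_ball n hn (p + β) (by linarith) (2 * R)).const_mul _)
    (Filter.Eventually.of_forall fun x t ht => by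
      have h1 : HasDerivAt (fun t : ℝ => f (t • x)) (fderiv ℝ f (t • x) x) t := by
        have h := (hdiff (t • x)).hasFDerivAt.comp_hasDerivAt t
          ((hasDerivAt_id t).smul_const x)
        simpa [Function.comp_def] using h
      exact ((hasDerivAt_abs_rpow (f (t • x)) hp1).comp t h1).div_const _)
  obtain ⟨hKint, hder3⟩ := hder2
  have hkey := hder1.unique hder3
  simp only [one_smul] at hkey hKint
  have hne : ∀ᵐ x : EuclideanSpace ℝ (Fin n), x ≠ 0 := by
    simp [ae_iff]
  have hpt : ∫ x : EuclideanSpace ℝ (Fin n), -(lam ^ (p - 1)) *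
      ((p * |f x| ^ (p - 2) * f x) * (fderiv ℝ f x x) / ‖x‖ ^ (p + β)) ≤
      ∫ x : EuclideanSpace ℝ (Fin n), ((p - 1) * lam ^ p * (|f x| ^ p / ‖x‖ ^ (p + β)) +
        |radDeriv f x| ^ p / ‖x‖ ^ β) := by
    refine integral_mono_ae (hKint.const_mul _) ((hIint.const_mul _).add hJint) ?_
    filter_upwards [hne] with x hx
    have hx0 : 0 < ‖x‖ := norm_pos_iff.mpr hx
    have hy := wh_young hp1 (c := lam * |f x|) (b := ‖x‖ * |radDeriv f x|) (by positivity)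
      (by positivity)
    rw [Real.mul_rpow hlam0.le (abs_nonneg _), Real.mul_rpow hlam0.le (abs_nonneg _),
      Real.mul_rpow hx0.le (abs_nonneg _)] at hy
    have hJ2 : |radDeriv f x| ^ p / ‖x‖ ^ β = ‖x‖ ^ p * |radDeriv f x| ^ p / ‖x‖ ^ (p + β) := by
      rw [Real.rpow_add hx0, mul_div_mul_left _ _ (Real.rpow_pos_of_pos hx0 _).ne']
    rw [hJ2, ← mul_div_assoc, ← mul_div_assoc, ← add_div]
    refine div_le_div_of_nonneg_right ?_ (Real.rpow_nonneg hx0.le _)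
    rw [wh_radDeriv_mul]
    have habs : -(|f x| ^ (p - 2) * f x * radDeriv f x) ≤ |f x| ^ (p - 1) * |radDeriv f x| := by
      rw [← wh_abs_rpow _ _ hp1]
      refine (neg_le_abs _).trans (le_of_eq ?_)
      rw [abs_mul, abs_mul, abs_of_nonneg (Real.rpow_nonneg (abs_nonneg _) _)]
    have := mul_le_mul_of_nonneg_left habs
      (by positivity : 0 ≤ p * lam ^ (p - 1) * ‖x‖)
    linarith
  rw [integral_const_mul, ← hkey, integral_add (hIint.const_mul _) hJint, integral_const_mul,
    ← hI, ← hJ] at hpt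
  have hl : lam ^ (p - 1) * (n - p - β) = p * lam ^ p := by
    have h1 : (n - p - β : ℝ) = p * lam := by rw [hlam]; field_simp
    have h2 : lam ^ p = lam ^ (p - 1) * lam := by
      rw [← Real.rpow_add_one hlam0.ne']; congr 1; ring
    rw [h1, h2]; ring
  have : -(lam ^ (p - 1)) * ((p + β - n) * I) = p * lam ^ p * I := by
    rw [← hl]; ring
  rw [this] at hpt
  linarith

/-- radial profile of the near-extremal functions -/
noncomputable def whG (φ : ContDiffBump (2 : ℝ)) (lam ε : ℝ) (r : ℝ) : ℝ :=
  Real.exp (-lam * Real.log r) * φ (ε * Real.log r)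

noncomputable def whF (φ : ContDiffBump (2 : ℝ)) (lam ε : ℝ) {n : ℕ}
    (x : EuclideanSpace ℝ (Fin n)) : ℝ := whG φ lam ε ‖x‖

lemma wh_bump_zero (φ : ContDiffBump (2 : ℝ)) (hφ : φ.rOut = 1) {s : ℝ} (hs : s ≤ 1 ∨ 3 ≤ s) :
    φ s = 0 := by
  apply φ.zero_of_le_dist
  rw [hφ, Real.dist_eq]
  rcases hs with hs | hs
  · exact le_trans (by linarith) (neg_le_abs _)
  · exact le_trans (by linarith) (le_abs_self _)

lemma whF_zero (φ : ContDiffBump (2 : ℝ)) (hφ : φ.rOut = 1) (lam ε : ℝ) (hε : 0 < ε) {n : ℕ}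
    (x : EuclideanSpace ℝ (Fin n)) (hx : ‖x‖ < 1 ∨ Real.exp (3 / ε) ≤ ‖x‖) :
    whF φ lam ε x = 0 := by
  unfold whF whG
  rw [wh_bump_zero φ hφ, mul_zero]
  rcases hx with hx | hx
  · left
    have := Real.log_nonpos (norm_nonneg x) hx.le
    nlinarith
  · right
    have h1 := (Real.le_log_iff_exp_le ((Real.exp_pos _).trans_le hx)).mpr hx
    rw [div_le_iff₀ hε] at h1
    linarith

lemma whF_contDiff (φ : ContDiffBump (2 : ℝ)) (hφ : φ.rOut = 1) (lam ε : ℝ) (hε : 0 < ε) {n : ℕ} :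
    ContDiff ℝ (⊤ : ℕ∞) (whF φ lam ε : EuclideanSpace ℝ (Fin n) → ℝ) := by
  rw [contDiff_iff_contDiffAt]
  intro x
  rcases eq_or_ne x 0 with rfl | hx
  · refine (contDiffAt_const (c := (0:ℝ))).congr_of_eventuallyEq ?_
    filter_upwards [Metric.ball_mem_nhds (0 : EuclideanSpace ℝ (Fin n)) one_pos] with y hy
    exact whF_zero φ hφ lam ε hε y (Or.inl (by simpa using hy))
  · have h1 : ContDiffAt ℝ (⊤ : ℕ∞) (fun x : EuclideanSpace ℝ (Fin n) => Real.log ‖x‖) x :=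
      (contDiffAt_norm ℝ hx).log (norm_ne_zero_iff.mpr hx)
    unfold whF whG
    exact (contDiffAt_const.mul h1).exp.mul
      ((φ.contDiff (n := ⊤)).contDiffAt.comp x (contDiffAt_const.mul h1))

lemma whF_compact (φ : ContDiffBump (2 : ℝ)) (hφ : φ.rOut = 1) (lam ε : ℝ) (hε : 0 < ε) {n : ℕ} :
    HasCompactSupport (whF φ lam ε : EuclideanSpace ℝ (Fin n) → ℝ) := by
  refine HasCompactSupport.intro (isCompact_closedBall 0 (Real.exp (3 / ε))) fun x hx => ?_
  exact whF_zero φ hφ lam ε hε x (Or.inr (by simpa using (not_le.mp (by simpa using hx)).le))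

lemma whG_deriv (φ : ContDiffBump (2 : ℝ)) (lam ε : ℝ) {r : ℝ} (hr : 0 < r) :
    HasDerivAt (whG φ lam ε) (Real.exp (-lam * Real.log r) * r⁻¹ *
      (-lam * φ (ε * Real.log r) + ε * deriv φ (ε * Real.log r))) r := by
  have h1 : HasDerivAt (fun r => -lam * Real.log r) (-lam * r⁻¹) r :=
    (Real.hasDerivAt_log hr.ne').const_mul _
  have h2 : HasDerivAt (fun r => ε * Real.log r) (ε * r⁻¹) r :=
    (Real.hasDerivAt_log hr.ne').const_mul _
  have hd : DifferentiableAt ℝ φ (ε * Real.log r) :=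
    ((φ.contDiff (n := 1)).differentiable (by simp)) _
  have h3 := h1.exp.mul (hd.hasDerivAt.comp r h2)
  refine h3.congr_deriv ?_
  simp only [Function.comp_apply]
  ring

lemma whF_radDeriv (φ : ContDiffBump (2 : ℝ)) (hφ : φ.rOut = 1) (lam ε : ℝ) (hε : 0 < ε) {n : ℕ}
    (x : EuclideanSpace ℝ (Fin n)) (hx : x ≠ 0) :
    radDeriv (whF φ lam ε) x = Real.exp (-lam * Real.log ‖x‖) * ‖x‖⁻¹ *
      (-lam * φ (ε * Real.log ‖x‖) + ε * deriv φ (ε * Real.log ‖x‖)) := by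
  have hx0 : 0 < ‖x‖ := norm_pos_iff.mpr hx
  have hdiff : Differentiable ℝ (whF φ lam ε : EuclideanSpace ℝ (Fin n) → ℝ) :=
    (whF_contDiff φ hφ lam ε hε).differentiable (by simp)
  have h1 : HasDerivAt (fun t : ℝ => t • (‖x‖⁻¹ • x)) (‖x‖⁻¹ • x) ‖x‖ := by
    simpa using (hasDerivAt_id ‖x‖).smul_const (‖x‖⁻¹ • x)
  have hxx : ‖x‖ • (‖x‖⁻¹ • x) = x := by
    rw [smul_smul, mul_inv_cancel₀ hx0.ne', one_smul]
  have h2 : HasDerivAt (fun t : ℝ => whF φ lam ε (t • (‖x‖⁻¹ • x)))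
      (radDeriv (whF φ lam ε) x) ‖x‖ := by
    have := (hdiff (‖x‖ • (‖x‖⁻¹ • x))).hasFDerivAt.comp_hasDerivAt ‖x‖ h1
    rw [hxx] at this
    exact this
  refine h2.unique ((whG_deriv φ lam ε hx0).congr_of_eventuallyEq ?_)
  filter_upwards [lt_mem_nhds hx0] with t ht
  unfold whF
  rw [norm_smul, norm_smul, norm_inv, norm_norm, inv_mul_cancel₀ hx0.ne', mul_one,
    Real.norm_of_nonneg ht.le]

/-- polar coordinates and logarithmic change of variables -/
lemma wh_polar (n : ℕ) (hn : 2 ≤ n) (h : ℝ → ℝ) (F : EuclideanSpace ℝ (Fin n) → ℝ)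
    (hF : ∀ x, x ≠ 0 → F x = ‖x‖ ^ (-(n : ℝ)) * h (Real.log ‖x‖)) :
    ∫ x, F x = (n * (volume : Measure (EuclideanSpace ℝ (Fin n))).real (Metric.ball 0 1)) *
      ∫ s, h s := by
  have := wh_nontrivial n hn
  have hne : ∀ᵐ x : EuclideanSpace ℝ (Fin n), x ≠ 0 := by
    simp [ae_iff]
  have h1 : ∫ x, F x = ∫ x : EuclideanSpace ℝ (Fin n),
      (fun r : ℝ => r ^ (-(n : ℝ)) * h (Real.log r)) ‖x‖ := by
    refine integral_congr_ae ?_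
    filter_upwards [hne] with x hx using hF x hx
  rw [h1, integral_fun_norm_addHaar volume (fun r : ℝ => r ^ (-(n : ℝ)) * h (Real.log r))]
  have hd : Module.finrank ℝ (EuclideanSpace ℝ (Fin n)) = n := by simp
  rw [hd, nsmul_eq_mul, smul_eq_mul, mul_assoc]
  congr 2
  have h2 := integral_image_eq_integral_abs_deriv_smul (s := Set.univ) (f := Real.exp)
    (f' := Real.exp) MeasurableSet.univ (fun x _ => (Real.hasDerivAt_exp x).hasDerivWithinAt)
    Real.exp_injective.injOn (fun y : ℝ => y ^ (n - 1) • (y ^ (-(n : ℝ)) * h (Real.log y)))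
  rw [Set.image_univ, Real.range_exp, setIntegral_univ] at h2
  rw [h2]
  refine integral_congr_ae (Filter.Eventually.of_forall fun s => ?_)
  simp only [smul_eq_mul, Real.log_exp, abs_of_pos (Real.exp_pos s)]
  rw [← mul_assoc, ← mul_assoc, ← pow_succ', Nat.sub_add_cancel (by omega), ← Real.rpow_natCast,
    ← Real.rpow_add (Real.exp_pos s)]
  simp

lemma wh_scale (h : ℝ → ℝ) (ε : ℝ) (hε : 0 < ε) (h0 : ∀ s ∉ Set.Icc (1:ℝ) 3, h s = 0) :
    ∫ s, h (ε * s) = ε⁻¹ * ∫ s in Set.Icc (1:ℝ) 3, h s := by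
  rw [setIntegral_eq_integral_of_forall_compl_eq_zero h0, Measure.integral_comp_mul_left,
    abs_of_pos (by positivity), smul_eq_mul]

theorem weighted_hardy_radial_sharp (n : ℕ) (hn : 2 ≤ n) (p β : ℝ) (hp1 : 1 < p)
    (hpn : p < n) (hβ : β < n - p) :
    sInf {r : ℝ | ∃ f : EuclideanSpace ℝ (Fin n) → ℝ, ContDiff ℝ (⊤ : ℕ∞) f ∧
        HasCompactSupport f ∧
        0 < ∫ x : EuclideanSpace ℝ (Fin n), |f x| ^ p / ‖x‖ ^ (p + β) ∧
        r = (∫ x : EuclideanSpace ℝ (Fin n), |radDeriv f x| ^ p / ‖x‖ ^ β) /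
              ∫ x : EuclideanSpace ℝ (Fin n), |f x| ^ p / ‖x‖ ^ (p + β)} =
      ((n - p - β) / p) ^ p := by
  set S := {r : ℝ | ∃ f : EuclideanSpace ℝ (Fin n) → ℝ, ContDiff ℝ (⊤ : ℕ∞) f ∧
        HasCompactSupport f ∧
        0 < ∫ x : EuclideanSpace ℝ (Fin n), |f x| ^ p / ‖x‖ ^ (p + β) ∧
        r = (∫ x : EuclideanSpace ℝ (Fin n), |radDeriv f x| ^ p / ‖x‖ ^ β) /
              ∫ x : EuclideanSpace ℝ (Fin n), |f x| ^ p / ‖x‖ ^ (p + β)} with hS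
  have hp0 : 0 < p := by linarith
  set lam := (n - p - β) / p with hlam
  have hlam0 : 0 < lam := by
    apply div_pos <;> linarith
  have hlp : lam * p = n - p - β := by rw [hlam]; field_simp
  have hlow : ∀ r ∈ S, lam ^ p ≤ r := by
    rintro r ⟨f, hf, hc, hpos, rfl⟩
    rw [le_div_iff₀ hpos]
    exact wh_hardy n hn p β hp1 hβ f hf hc
  let φ : ContDiffBump (2 : ℝ) := ⟨1 / 2, 1, by norm_num, by norm_num⟩
  have hφ : φ.rOut = 1 := rfl
  have hφ0 : ∀ s ∉ Set.Icc (1:ℝ) 3, φ s = 0 := fun s hs => by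
    apply wh_bump_zero φ hφ
    by_contra h
    push Not at h
    exact hs ⟨h.1.le, h.2.le⟩
  have hφd : ∀ s ∉ Set.Icc (1:ℝ) 3, deriv φ s = 0 := fun s hs => by
    have : φ =ᶠ[nhds s] fun _ => (0:ℝ) := by
      filter_upwards [isClosed_Icc.isOpen_compl.mem_nhds hs] with t ht using hφ0 t ht
    rw [this.deriv_eq]
    simp
  have hφc : Continuous φ := φ.continuous
  have hφdc : Continuous (deriv φ) := (φ.contDiff (n := 1)).continuous_deriv (by simp)
  set K : ℝ → ℝ := fun ε => ∫ s in Set.Icc (1:ℝ) 3, |-lam * φ s + ε * deriv φ s| ^ p with hK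
  set A : ℝ := ∫ s in Set.Icc (1:ℝ) 3, |φ s| ^ p with hA
  set c : ℝ := n * (volume : Measure (EuclideanSpace ℝ (Fin n))).real (Metric.ball 0 1) with hcdef
  have hc0 : 0 < c := by
    refine mul_pos (by exact_mod_cast (by omega : 0 < n)) ?_
    exact ENNReal.toReal_pos (Metric.measure_ball_pos _ _ one_pos).ne' measure_ball_lt_top.ne
  have hA0 : 0 < A := by
    have hcont : Continuous (fun s => |φ s| ^ p) :=
      hφc.abs.rpow_const fun _ => Or.inr hp0.le
    rw [hA, setIntegral_eq_integral_of_forall_compl_eq_zero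
      (fun s hs => by simp [hφ0 s hs, Real.zero_rpow hp0.ne'])]
    refine hcont.integral_pos_of_hasCompactSupport_nonneg_nonzero ?_ (fun s => by positivity)
      (x := 2) ?_
    · exact HasCompactSupport.intro (isCompact_Icc (a := (1:ℝ)) (b := 3))
        (fun s hs => by simp [hφ0 s hs, Real.zero_rpow hp0.ne'])
    · rw [φ.one_of_mem_closedBall (Metric.mem_closedBall_self φ.rIn_pos.le)]
      simp
  have hI : ∀ ε : ℝ, 0 < ε → ∫ x : EuclideanSpace ℝ (Fin n),
      |whF φ lam ε x| ^ p / ‖x‖ ^ (p + β) = c * (ε⁻¹ * A) := by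
    intro ε hε
    rw [hA, ← wh_scale (fun s => |φ s| ^ p) ε hε
      (fun s hs => by simp [hφ0 s hs, Real.zero_rpow hp0.ne']), hcdef]
    refine wh_polar n hn (fun s => |φ (ε * s)| ^ p) _ fun x hx => ?_
    have hx0 : 0 < ‖x‖ := norm_pos_iff.mpr hx
    simp only [whF, whG]
    rw [abs_mul, abs_of_pos (Real.exp_pos _), mul_comm (-lam), ← Real.rpow_def_of_pos hx0,
      Real.mul_rpow (by positivity) (by positivity), ← Real.rpow_mul hx0.le, mul_div_right_comm,
      ← Real.rpow_sub hx0]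
    congr 2
    linarith
  have hJ : ∀ ε : ℝ, 0 < ε → ∫ x : EuclideanSpace ℝ (Fin n),
      |radDeriv (whF φ lam ε) x| ^ p / ‖x‖ ^ β = c * (ε⁻¹ * K ε) := by
    intro ε hε
    simp only [hK]
    rw [← wh_scale (fun s => |-lam * φ s + ε * deriv φ s| ^ p) ε hε
      (fun s hs => by simp [hφ0 s hs, hφd s hs, Real.zero_rpow hp0.ne']), hcdef]
    refine wh_polar n hn
      (fun s => |-lam * φ (ε * s) + ε * deriv φ (ε * s)| ^ p) _ fun x hx => ?_
    have hx0 : 0 < ‖x‖ := norm_pos_iff.mpr hx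
    rw [whF_radDeriv φ hφ lam ε hε x hx, abs_mul, abs_mul, abs_of_pos (Real.exp_pos _),
      abs_of_pos (inv_pos.mpr hx0), mul_comm (-lam) (Real.log _), ← Real.rpow_def_of_pos hx0,
      ← Real.rpow_neg_one, ← Real.rpow_add hx0,
      Real.mul_rpow (by positivity) (by positivity), ← Real.rpow_mul hx0.le, mul_div_right_comm,
      ← Real.rpow_sub hx0]
    congr 2
    linarith
  have hmem : ∀ ε : ℝ, 0 < ε → K ε / A ∈ S := by
    intro ε hε
    refine ⟨whF φ lam ε, whF_contDiff φ hφ lam ε hε, whF_compact φ hφ lam ε hε, ?_, ?_⟩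
    · rw [hI ε hε]; positivity
    · rw [hI ε hε, hJ ε hε]
      have := hA0.ne'
      have := hc0.ne'
      field_simp
  have hKc : Continuous K := by
    refine continuous_parametric_integral_of_continuous ?_ isCompact_Icc
    refine Continuous.rpow_const ?_ fun _ => Or.inr hp0.le
    fun_prop
  have hK0 : K 0 / A = lam ^ p := by
    rw [div_eq_iff hA0.ne']
    simp only [hK, hA]
    rw [← integral_const_mul]
    congr 1
    ext s
    rw [zero_mul, add_zero, abs_mul, abs_neg, abs_of_pos hlam0,
      Real.mul_rpow hlam0.le (abs_nonneg _)]
  refine le_antisymm ?_ (le_csInf ⟨_, hmem 1 one_pos⟩ hlow)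
  have ht : Filter.Tendsto (fun ε => K ε / A) (nhdsWithin 0 (Set.Ioi 0)) (nhds (lam ^ p)) := by
    rw [← hK0]
    exact ((hKc.div_const A).tendsto 0).mono_left nhdsWithin_le_nhds
  refine ge_of_tendsto ht ?_
  filter_upwards [self_mem_nhdsWithin] with ε hε
  exact csInf_le ⟨_, hlow⟩ (hmem ε hε)
end

section
/- Let n ≥ 2 be an integer and p ∈ (1, ∞). Then for every f ∈ C_c^∞(B), ((p−1)/p)^p ∫_B |f(x)|^p / ( |x|^n (log(1/|x|))^p ) dx ≤ ∫_B |∂_r f(x)|^p / |x|^{n−p} dx. -/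
open MeasureTheory

open Set Metric

lemma polar_lint {E : Type*} [NormedAddCommGroup E] [NormedSpace ℝ E] [MeasurableSpace E]
    [BorelSpace E] [FiniteDimensional ℝ E] [Nontrivial E] (μ : Measure E) [μ.IsAddHaarMeasure]
    (F : E → ENNReal) (hF : Measurable F) :
    ∫⁻ x, F x ∂μ = ∫⁻ ω : sphere (0 : E) 1, (∫⁻ r in Ioi (0 : ℝ),
      ENNReal.ofReal (r ^ (Module.finrank ℝ E - 1)) * F (r • (ω : E))) ∂μ.toSphere := by
  calc
    ∫⁻ x, F x ∂μ = ∫⁻ x : ({(0)}ᶜ : Set E), F x.1 ∂(μ.comap (↑)) := by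
      rw [lintegral_subtype_comap (measurableSet_singleton _).compl,
        restrict_compl_singleton]
    _ = ∫⁻ z, F (z.2.1 • (z.1 : E)) ∂μ.toSphere.prod (.volumeIoiPow (Module.finrank ℝ E - 1)) := by
      rw [← μ.measurePreserving_homeomorphUnitSphereProd.lintegral_comp_emb
        (Homeomorph.measurableEmbedding _)]
      refine lintegral_congr fun x => ?_
      congr 1
      have h0 : ‖(x : E)‖ ≠ 0 := norm_ne_zero_iff.2 x.2
      simp [smul_smul, h0]
    _ = _ := by
      rw [lintegral_prod _ (by fun_prop)]
      refine lintegral_congr fun ω => ?_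
      rw [Measure.volumeIoiPow, lintegral_withDensity_eq_lintegral_mul _ (by fun_prop) (by fun_prop)]
      simp only [Pi.mul_apply]
      rw [lintegral_subtype_comap measurableSet_Ioi (fun r : ℝ => ENNReal.ofReal (r ^ (Module.finrank ℝ E - 1)) * F (r • (ω : E)))]

lemma polar_ball {E : Type*} [NormedAddCommGroup E] [NormedSpace ℝ E] [MeasurableSpace E]
    [BorelSpace E] [FiniteDimensional ℝ E] [Nontrivial E] (μ : Measure E) [μ.IsAddHaarMeasure]
    (F : E → ENNReal) (hF : Measurable F) :
    ∫⁻ x in ball (0 : E) 1, F x ∂μ = ∫⁻ ω : sphere (0 : E) 1, (∫⁻ r in Ioo (0 : ℝ) 1,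
      ENNReal.ofReal (r ^ (Module.finrank ℝ E - 1)) * F (r • (ω : E))) ∂μ.toSphere := by
  rw [← lintegral_indicator measurableSet_ball, polar_lint μ _ (hF.indicator measurableSet_ball)]
  refine lintegral_congr fun ω => ?_
  rw [← lintegral_indicator measurableSet_Ioi, ← lintegral_indicator measurableSet_Ioo]
  refine lintegral_congr fun r => ?_
  by_cases h0 : 0 < r
  · by_cases h1 : r < 1 <;> simp [indicator, norm_smul, abs_of_pos h0, h0, h1]
  · simp [indicator, h0]

lemma alg_aux {p : ℝ} (hp : 1 < p) {X B : ℝ} (hX : 0 ≤ X) (hB : 0 ≤ B) :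
    p * (X ^ (p - 1) * B) ≤ (p - 1) * X ^ p + B ^ p := by
  have hc : (p / (p - 1)).HolderConjugate p := (Real.HolderConjugate.conjExponent hp).symm
  have h := Real.young_inequality_of_nonneg (Real.rpow_nonneg hX (p - 1)) hB hc
  have hp1 : p - 1 ≠ 0 := by linarith
  rw [← Real.rpow_mul hX, mul_div_cancel₀ _ hp1] at h
  have := mul_le_mul_of_nonneg_left h (by linarith : (0:ℝ) ≤ p)
  refine this.trans_eq ?_
  field_simp

/-- pointwise inequality -/
lemma pt_aux {p : ℝ} (hp : 1 < p) {y z r L : ℝ} (hr : 0 < r) (hL : 0 < L) :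
    ((p - 1) / p) ^ p * (|y| ^ p / (r * L ^ p)) - |z| ^ p * r ^ (p - 1) ≤
      ((p - 1) / p) ^ (p - 1) * ((p * |y| ^ (p - 2) * y * z) * L ^ (1 - p) +
        |y| ^ p * (-r⁻¹ * (1 - p) * L ^ (1 - p - 1))) := by
  set k := (p - 1) / p with hk
  have hk0 : 0 < k := div_pos (by linarith) (by linarith)
  have h := alg_aux hp (X := k * (|y| / L)) (B := |z| * r) (by positivity) (by positivity)
  have e1 : |z| ^ p * r ^ (p - 1) = (|z| * r) ^ p / r := by
    rw [Real.mul_rpow (abs_nonneg _) hr.le, Real.rpow_sub_one hr.ne']; ring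
  have e2 : k ^ p * (|y| ^ p / (r * L ^ p)) = (k * (|y| / L)) ^ p / r := by
    rw [Real.mul_rpow hk0.le (by positivity), Real.div_rpow (abs_nonneg _) hL.le]; field_simp
  have e3 : L ^ (1 - p - 1) = (L ^ p)⁻¹ := by
    rw [← Real.rpow_neg hL.le]; ring_nf
  have e4 : L ^ (1 - p) = (L ^ (p - 1))⁻¹ := by
    rw [← Real.rpow_neg hL.le]; ring_nf
  have e5 : |(|y| ^ (p - 2) * y)| = |y| ^ (p - 1) := by
    rcases eq_or_ne y 0 with rfl | hy
    · rw [abs_zero, Real.zero_rpow (by linarith : p - 1 ≠ 0)]; simp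
    · have : 0 < |y| := abs_pos.2 hy
      rw [abs_mul, abs_of_pos (by positivity), ← Real.rpow_add_one this.ne']; ring_nf
  have e6 : k ^ (p - 1) * (|y| ^ p * (-r⁻¹ * (1 - p) * L ^ (1 - p - 1))) =
      p * (k * (|y| / L)) ^ p / r := by
    rw [e3, Real.mul_rpow hk0.le (by positivity), Real.div_rpow (abs_nonneg _) hL.le,
      Real.rpow_sub_one hk0.ne']
    have : p - 1 ≠ 0 := by linarith
    rw [hk]; field_simp; ring
  have e7 : -(p * ((k * (|y| / L)) ^ (p - 1) * (|z| * r)) / r) ≤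
      k ^ (p - 1) * ((p * |y| ^ (p - 2) * y * z) * L ^ (1 - p)) := by
    rw [e4, Real.mul_rpow hk0.le (by positivity), Real.div_rpow (abs_nonneg _) hL.le, ← e5]
    have h1 := neg_abs_le (|y| ^ (p - 2) * y * z)
    rw [abs_mul] at h1
    have hc : 0 ≤ k ^ (p - 1) * (p * (L ^ (p - 1))⁻¹) := by positivity
    have h2 := mul_le_mul_of_nonneg_left h1 hc
    refine le_trans (le_of_eq ?_) (h2.trans (le_of_eq ?_))
    · field_simp
    · ring
  rw [mul_add, e6, e1, e2]
  have h3 := div_le_div_of_nonneg_right h hr.le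
  rw [add_div] at h3
  have : p * (k * (|y| / L)) ^ p / r = (p - 1) * (k * (|y| / L)) ^ p / r + (k * (|y| / L)) ^ p / r := by ring
  linarith

lemma one_dim_eps {p : ℝ} (hp : 1 < p) {g g' : ℝ → ℝ} (hg : ∀ r, HasDerivAt g (g' r) r)
    (hg' : Continuous g') {ε b : ℝ} (hε : 0 < ε) (hεb : ε ≤ b) (hb : b < 1) (hgb : g b = 0) :
    ENNReal.ofReal (((p - 1) / p) ^ p) *
      ∫⁻ r in Ioc ε b, ENNReal.ofReal (|g r| ^ p / (r * Real.log (1 / r) ^ p)) ≤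
      ∫⁻ r in Ioc ε b, ENNReal.ofReal (|g' r| ^ p * r ^ (p - 1)) := by
  have hgc : Continuous g := continuous_iff_continuousAt.2 fun r => (hg r).continuousAt
  have hpos : ∀ r ∈ Icc ε b, 0 < r := fun r hr => hε.trans_le hr.1
  have hL : ∀ r ∈ Icc ε b, 0 < Real.log (1 / r) := fun r hr =>
    Real.log_pos (by rw [one_lt_div (hpos r hr)]; linarith [hr.2])
  have hLc : ContinuousOn (fun r : ℝ => Real.log (1 / r)) (Icc ε b) := by
    refine ContinuousOn.log (continuousOn_const.div continuousOn_id fun r hr => (hpos r hr).ne') ?_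
    intro r hr; have := hpos r hr; positivity
  have hgp : Continuous fun r => |g r| ^ p := hgc.abs.rpow_const fun _ => Or.inr (by linarith)
  have hgp' : Continuous fun r => |g' r| ^ p := hg'.abs.rpow_const fun _ => Or.inr (by linarith)
  have hu : ContinuousOn (fun r => |g r| ^ p / (r * Real.log (1 / r) ^ p)) (Icc ε b) := by
    refine hgp.continuousOn.div (continuousOn_id.mul
      (hLc.rpow_const fun r hr => Or.inl (hL r hr).ne')) fun r hr => ?_
    have := hpos r hr; have := hL r hr; positivity
  have hv : ContinuousOn (fun r => |g' r| ^ p * r ^ (p - 1)) (Icc ε b) :=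
    hgp'.continuousOn.mul (continuousOn_id.rpow_const fun r hr => Or.inl (hpos r hr).ne')
  have hui := hu.integrableOn_Icc (μ := volume)
  have hvi := hv.integrableOn_Icc (μ := volume)
  have huiv : IntervalIntegrable (fun r => |g r| ^ p / (r * Real.log (1 / r) ^ p)) volume ε b :=
    hu.intervalIntegrable_of_Icc hεb
  have hviv : IntervalIntegrable (fun r => |g' r| ^ p * r ^ (p - 1)) volume ε b :=
    hv.intervalIntegrable_of_Icc hεb
  have key := intervalIntegral.integral_le_sub_of_hasDeriv_right_of_le hεb
    (g := fun r => ((p - 1) / p) ^ (p - 1) * (|g r| ^ p * Real.log (1 / r) ^ (1 - p)))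
    (g' := fun r => ((p - 1) / p) ^ (p - 1) * ((p * |g r| ^ (p - 2) * g r * g' r) *
      Real.log (1 / r) ^ (1 - p) +
        |g r| ^ p * (-r⁻¹ * (1 - p) * Real.log (1 / r) ^ (1 - p - 1))))
    (φ := fun r => ((p - 1) / p) ^ p * (|g r| ^ p / (r * Real.log (1 / r) ^ p)) -
      |g' r| ^ p * r ^ (p - 1))
    (continuousOn_const.mul (hgp.continuousOn.mul
      (hLc.rpow_const fun r hr => Or.inl (hL r hr).ne')))
    (by
      intro r hr
      have hr' := Ioo_subset_Icc_self hr
      have h1 : HasDerivAt (fun r => |g r| ^ p) (p * |g r| ^ (p - 2) * g r * g' r) r :=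
        (hasDerivAt_abs_rpow (g r) hp).comp r (hg r)
      have h2 : HasDerivAt (fun r : ℝ => Real.log (1 / r)) (-r⁻¹) r := by
        have := (Real.hasDerivAt_log (hpos r hr').ne').neg
        refine this.congr_of_eventuallyEq (Filter.Eventually.of_forall fun x => ?_)
        simp
      exact ((h1.mul (h2.rpow_const (Or.inl (hL r hr').ne'))).const_mul _).hasDerivWithinAt)
    ((hui.const_mul _).sub hvi)
    (by
      intro r hr
      have hr' := Ioo_subset_Icc_self hr
      exact pt_aux hp (hpos r hr') (hL r hr'))
  have hend : (0:ℝ) ≤ ((p - 1) / p) ^ (p - 1) * (|g ε| ^ p * Real.log (1 / ε) ^ (1 - p)) := by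
    have := hL ε ⟨le_rfl, hεb⟩
    have : 0 ≤ (p - 1) / p := div_nonneg (by linarith) (by linarith)
    positivity
  rw [intervalIntegral.integral_sub (huiv.const_mul _) hviv, intervalIntegral.integral_const_mul,
    intervalIntegral.integral_of_le hεb, intervalIntegral.integral_of_le hεb] at key
  simp only [hgb, abs_zero, Real.zero_rpow (by linarith : p ≠ 0), zero_mul, mul_zero] at key
  rw [← ofReal_integral_eq_lintegral_ofReal (hui.mono_set Ioc_subset_Icc_self),
    ← ofReal_integral_eq_lintegral_ofReal (hvi.mono_set Ioc_subset_Icc_self),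
    ← ENNReal.ofReal_mul]
  · exact ENNReal.ofReal_le_ofReal (by linarith)
  · have : 0 ≤ (p - 1) / p := div_nonneg (by linarith) (by linarith)
    positivity
  · filter_upwards [ae_restrict_mem measurableSet_Ioc] with r hr
    have := hpos r (Ioc_subset_Icc_self hr)
    show (0:ℝ) ≤ _
    positivity
  · filter_upwards [ae_restrict_mem measurableSet_Ioc] with r hr
    have := hpos r (Ioc_subset_Icc_self hr)
    have := hL r (Ioc_subset_Icc_self hr)
    show (0:ℝ) ≤ _
    positivity

lemma one_dim {p : ℝ} (hp : 1 < p) {g g' : ℝ → ℝ} (hg : ∀ r, HasDerivAt g (g' r) r)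
    (hg' : Continuous g') {b : ℝ} (hb0 : 0 < b) (hb : b < 1) (hgb : ∀ r, b ≤ r → g r = 0) :
    ENNReal.ofReal (((p - 1) / p) ^ p) *
      ∫⁻ r in Ioo 0 1, ENNReal.ofReal (|g r| ^ p / (r * Real.log (1 / r) ^ p)) ≤
      ∫⁻ r in Ioo 0 1, ENNReal.ofReal (|g' r| ^ p * r ^ (p - 1)) := by
  set s : ℕ → Set ℝ := fun k => Ioc (b / (k + 1)) b with hs
  have hun : Ioc 0 b = ⋃ k, s k := by
    ext r
    simp only [hs, mem_iUnion, mem_Ioc]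
    constructor
    · rintro ⟨h0, h1⟩
      obtain ⟨k, hk⟩ := exists_nat_gt (b / r)
      refine ⟨k, ?_, h1⟩
      rw [div_lt_iff₀ h0] at hk
      rw [div_lt_iff₀ (by positivity)]
      nlinarith
    · rintro ⟨k, h0, h1⟩
      exact ⟨lt_trans (by positivity) h0, h1⟩
  have hmono : Monotone s := by
    intro i j hij
    apply Ioc_subset_Ioc_left
    gcongr
  have hsub : Ioo (0:ℝ) 1 ⊆ Ioc 0 b ∪ Ioo b 1 := by
    intro r hr
    rcases le_or_gt r b with h | h
    · exact Or.inl ⟨hr.1, h⟩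
    · exact Or.inr ⟨h, hr.2⟩
  have hz : ∫⁻ r in Ioo b 1, ENNReal.ofReal (|g r| ^ p / (r * Real.log (1 / r) ^ p)) = 0 := by
    rw [setLIntegral_congr_fun (g := fun _ => 0) measurableSet_Ioo]
    · simp
    · intro r hr
      simp [hgb r hr.1.le, Real.zero_rpow (by linarith : p ≠ 0)]
  calc _ ≤ ENNReal.ofReal (((p - 1) / p) ^ p) *
      ∫⁻ r in Ioc 0 b, ENNReal.ofReal (|g r| ^ p / (r * Real.log (1 / r) ^ p)) := by
        refine mul_le_mul_right ?_ _
        refine (lintegral_mono_set hsub).trans ((lintegral_union_le _ _ _).trans ?_)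
        rw [hz, add_zero]
    _ ≤ _ := by
      rw [hun, setLIntegral_iUnion_of_directed _ hmono.directed_le, ENNReal.mul_iSup]
      refine iSup_le fun k => ?_
      refine (one_dim_eps hp hg hg' (by positivity) (div_le_self hb0.le (by simp)) hb
        (hgb b le_rfl)).trans (lintegral_mono_set ?_)
      intro r hr
      exact ⟨lt_trans (by positivity) hr.1, hr.2.trans_lt hb⟩

theorem critical_hardy_radial (n : ℕ) (hn : 2 ≤ n) (p : ℝ) (hp1 : 1 < p)
    (f : EuclideanSpace ℝ (Fin n) → ℝ) (hf : ContDiff ℝ (⊤ : ℕ∞) f) (hfc : HasCompactSupport f)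
    (hsupp : tsupport f ⊆ Metric.ball (0 : EuclideanSpace ℝ (Fin n)) 1) :
    ((p - 1) / p) ^ p *
        ∫ x in Metric.ball (0 : EuclideanSpace ℝ (Fin n)) 1,
          |f x| ^ p / (‖x‖ ^ (n : ℝ) * Real.log (1 / ‖x‖) ^ p) ≤
      ∫ x in Metric.ball (0 : EuclideanSpace ℝ (Fin n)) 1,
        |radDeriv f x| ^ p / ‖x‖ ^ ((n : ℝ) - p) := by
  have : NeZero n := ⟨by omega⟩
  have hdim : Module.finrank ℝ (EuclideanSpace ℝ (Fin n)) = n := by simp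
  have hnt : Nontrivial (EuclideanSpace ℝ (Fin n)) :=
    Module.nontrivial_of_finrank_pos (R := ℝ) (by omega)
  have hk0 : 0 ≤ ((p - 1) / p) ^ p :=
    Real.rpow_nonneg (div_nonneg (by linarith) (by linarith)) _
  have hfcont : Continuous f := hf.continuous
  have hdf : Continuous (fderiv ℝ f) := hf.continuous_fderiv (by simp)
  have hdiff : Differentiable ℝ f := hf.differentiable (by simp)
  have hrm : Measurable (radDeriv f) := by
    have : radDeriv f = fun x => ‖x‖⁻¹ * fderiv ℝ f x x := by
      ext x; simp [radDeriv]
    rw [this]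
    exact measurable_norm.inv.mul (hdf.clm_apply continuous_id).measurable
  have hum : Measurable fun x : EuclideanSpace ℝ (Fin n) =>
      |f x| ^ p / (‖x‖ ^ (n : ℝ) * Real.log (1 / ‖x‖) ^ p) := by
    have := hfcont.measurable
    have h1 : Measurable fun x : EuclideanSpace ℝ (Fin n) => |f x| := this.abs
    fun_prop
  have hvm : Measurable fun x : EuclideanSpace ℝ (Fin n) =>
      |radDeriv f x| ^ p / ‖x‖ ^ ((n : ℝ) - p) := by
    have h1 : Measurable fun x : EuclideanSpace ℝ (Fin n) => |radDeriv f x| := hrm.abs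
    fun_prop
  -- integrability of the right side
  obtain ⟨C, hC⟩ := (hfc.fderiv (𝕜 := ℝ)).exists_bound_of_continuous hdf
  have hC0 : 0 ≤ C := (norm_nonneg _).trans (hC 0)
  have hrb : ∀ x, |radDeriv f x| ≤ C := by
    intro x
    have h1 : ‖(‖x‖⁻¹ • x)‖ ≤ 1 := by
      rw [norm_smul, norm_inv, norm_norm]; exact inv_mul_le_one
    calc |radDeriv f x| = ‖fderiv ℝ f x (‖x‖⁻¹ • x)‖ := rfl
      _ ≤ ‖fderiv ℝ f x‖ * ‖(‖x‖⁻¹ • x)‖ := ContinuousLinearMap.le_opNorm _ _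
      _ ≤ C * 1 := mul_le_mul (hC x) h1 (norm_nonneg _) hC0
      _ = C := mul_one C
  have hvint : IntegrableOn (fun x : EuclideanSpace ℝ (Fin n) =>
      |radDeriv f x| ^ p / ‖x‖ ^ ((n : ℝ) - p)) (ball 0 1) := by
    refine integrableOn_ball_of_norm_le_rpow (C := C ^ p) (α := n - p) (by omega)
      (by rw [hdim]; linarith) (Filter.Eventually.of_forall fun x => ?_) hvm.aestronglyMeasurable
    rw [Real.norm_of_nonneg (by positivity), Real.rpow_neg (norm_nonneg _), div_eq_mul_inv]
    gcongr
    exact hrb x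
  obtain ⟨b, ⟨hb0, hb1⟩, hb⟩ := exists_pos_lt_subset_ball one_pos (isClosed_tsupport f) hsupp
  have hu0 : ∀ᵐ x ∂(volume.restrict (ball (0 : EuclideanSpace ℝ (Fin n)) 1)),
      0 ≤ |f x| ^ p / (‖x‖ ^ (n : ℝ) * Real.log (1 / ‖x‖) ^ p) := by
    filter_upwards [ae_restrict_mem measurableSet_ball] with x hx
    have hx1 : ‖x‖ < 1 := by simpa using hx
    have : 0 ≤ Real.log (1 / ‖x‖) := by
      rw [one_div, Real.log_inv]
      linarith [Real.log_nonpos (norm_nonneg x) hx1.le]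
    positivity
  have hv0 : ∀ᵐ x ∂(volume.restrict (ball (0 : EuclideanSpace ℝ (Fin n)) 1)),
      0 ≤ |radDeriv f x| ^ p / ‖x‖ ^ ((n : ℝ) - p) :=
    Filter.Eventually.of_forall fun x => by positivity
  have main : ENNReal.ofReal (((p - 1) / p) ^ p) *
      ∫⁻ x in ball (0 : EuclideanSpace ℝ (Fin n)) 1,
        ENNReal.ofReal (|f x| ^ p / (‖x‖ ^ (n : ℝ) * Real.log (1 / ‖x‖) ^ p)) ≤
      ∫⁻ x in ball (0 : EuclideanSpace ℝ (Fin n)) 1,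
        ENNReal.ofReal (|radDeriv f x| ^ p / ‖x‖ ^ ((n : ℝ) - p)) := by
    rw [polar_ball _ _ hum.ennreal_ofReal, polar_ball _ _ hvm.ennreal_ofReal,
      ← lintegral_const_mul' _ _ ENNReal.ofReal_ne_top]
    refine lintegral_mono fun ω => ?_
    have hω : ‖(ω : EuclideanSpace ℝ (Fin n))‖ = 1 := by simp
    have hray : ∀ r : ℝ, HasDerivAt (fun r : ℝ => r • (ω : EuclideanSpace ℝ (Fin n))) ω r := by
      intro r
      simpa using (hasDerivAt_id r).smul_const (ω : EuclideanSpace ℝ (Fin n))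
    have h1 := one_dim hp1 (g := fun r => f (r • (ω : EuclideanSpace ℝ (Fin n))))
      (g' := fun r => fderiv ℝ f (r • (ω : EuclideanSpace ℝ (Fin n))) ω)
      (fun r => (hdiff _).hasFDerivAt.comp_hasDerivAt r (hray r))
      ((hdf.comp (continuous_id.smul continuous_const)).clm_apply continuous_const) hb0 hb1
      (by
        intro r hr
        apply image_eq_zero_of_notMem_tsupport
        intro hmem
        have := hb hmem
        rw [mem_ball_zero_iff, norm_smul, hω, Real.norm_of_nonneg (hb0.le.trans hr)] at this
        linarith)
    have hpw : ∀ r : ℝ, 0 < r → r ^ (n - 1) = r ^ (n : ℝ) / r := by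
      intro r hr
      rw [← Real.rpow_sub_one hr.ne', ← Real.rpow_natCast, Nat.cast_sub (by omega)]
      simp
    convert h1 using 1
    · congr 1
      refine setLIntegral_congr_fun measurableSet_Ioo fun r hr => ?_
      have h0 : 0 < r := hr.1
      have hn0 : 0 < r ^ (n : ℝ) := by positivity
      rw [← ENNReal.ofReal_mul (by positivity), hdim, hpw r h0, norm_smul, hω,
        Real.norm_of_nonneg h0.le, mul_one]
      congr 1
      field_simp
    · refine setLIntegral_congr_fun measurableSet_Ioo fun r hr => ?_
      have h0 : 0 < r := hr.1
      have hn0 : 0 < r ^ (n : ℝ) := by positivity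
      have hp0 : 0 < r ^ p := by positivity
      have hrd : radDeriv f (r • (ω : EuclideanSpace ℝ (Fin n))) =
          fderiv ℝ f (r • (ω : EuclideanSpace ℝ (Fin n))) ω := by
        rw [radDeriv, norm_smul, hω, Real.norm_of_nonneg h0.le, mul_one, smul_smul,
          inv_mul_cancel₀ h0.ne', one_smul]
      rw [← ENNReal.ofReal_mul (by positivity), hdim, hpw r h0, hrd, norm_smul, hω,
        Real.norm_of_nonneg h0.le, mul_one, Real.rpow_sub h0, Real.rpow_sub_one h0.ne']
      congr 1
      field_simp
  rw [integral_eq_lintegral_of_nonneg_ae hu0 hum.aestronglyMeasurable,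
    integral_eq_lintegral_of_nonneg_ae hv0 hvm.aestronglyMeasurable]
  have hfin : ∫⁻ x in ball (0 : EuclideanSpace ℝ (Fin n)) 1,
        ENNReal.ofReal (|radDeriv f x| ^ p / ‖x‖ ^ ((n : ℝ) - p)) ≠ ⊤ := by
    rw [← ofReal_integral_eq_lintegral_ofReal hvint hv0]
    exact ENNReal.ofReal_ne_top
  have := ENNReal.toReal_mono hfin main
  rwa [ENNReal.toReal_mul, ENNReal.toReal_ofReal hk0] at this
end

section
/- Let n ≥ 2 be an integer. Then for every f ∈ C_c^∞(B), ((n−1)/n)^n ∫_B |f(x)|^n / ( |x|^n (log(1/|x|))^n ) dx ≤ ∫_B |∇f(x)|^n dx. -/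
open MeasureTheory

/-- Bernoulli / Young in homogeneous form. -/
lemma ch_young (n : ℕ) (hn : 1 ≤ n) (a b : ℝ) (ha : 0 ≤ a) (hb : 0 ≤ b) :
    n * a ^ (n - 1) * b ≤ (n - 1) * a ^ n + b ^ n := by
  rcases ha.eq_or_lt with rfl | ha
  · rcases Nat.lt_or_ge 1 n with h | h
    · have : n - 1 ≠ 0 := by omega
      have : n ≠ 0 := by omega
      simp [*]
    · obtain rfl : n = 1 := by omega
      simp
  · have h := one_add_mul_sub_le_pow (a := b / a) (by have : 0 ≤ b / a := by positivity
                                                      linarith) n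
    have h2 := mul_le_mul_of_nonneg_left h (pow_nonneg ha.le n)
    rw [div_pow, mul_div_cancel₀ _ (by positivity)] at h2
    obtain ⟨m, rfl⟩ : ∃ m, n = m + 1 := ⟨n - 1, by omega⟩
    have e : a ^ (m + 1) * (1 + ((m + 1 : ℕ) : ℝ) * (b / a - 1))
      = ((m + 1 : ℕ) : ℝ) * a ^ m * b - (((m + 1 : ℕ) : ℝ) - 1) * a ^ (m + 1) := by
      field_simp; ring
    rw [e] at h2
    simp only [Nat.add_sub_cancel]
    linarith

lemma ch_deriv (n : ℕ) (hn : 2 ≤ n) (u : ℝ → ℝ) (v r : ℝ) (hr : 0 < r) (hr1 : r < 1)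
    (hu : HasDerivAt u v r) :
    HasDerivAt (fun r => |u r| ^ n / (-Real.log r) ^ (n - 1))
      ((n * |u r| ^ (n - 2) * u r * v) / (-Real.log r) ^ (n - 1)
        + (n - 1) * |u r| ^ n / ((-Real.log r) ^ n * r)) r := by
  have hL : 0 < -Real.log r := by have := Real.log_neg hr hr1; linarith
  have h1 : HasDerivAt (fun x : ℝ => |x| ^ n) (n * |u r| ^ (n - 2) * u r) (u r) := by
    have := hasDerivAt_abs_rpow (u r) (p := n) (by exact_mod_cast hn)
    have e : ((n : ℝ) - 2) = ((n - 2 : ℕ) : ℝ) := by push_cast [Nat.cast_sub hn]; ring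
    rw [e] at this
    simpa only [Real.rpow_natCast] using this
  have h2 := h1.comp r hu
  have h3 := ((Real.hasDerivAt_log hr.ne').neg).pow (n - 1)
  have h4 := h2.div h3 (by simpa using (pow_pos hL (n - 1)).ne')
  refine h4.congr_deriv ?_
  obtain ⟨m, rfl⟩ : ∃ m, n = m + 2 := ⟨n - 2, by omega⟩
  simp only [Function.comp, Pi.neg_apply, Pi.pow_apply, Nat.add_sub_cancel,
    show m + 2 - 1 = m + 1 by omega]
  generalize -Real.log r = L at *
  push_cast
  field_simp
  ring

lemma ch_pointwise (n : ℕ) (hn : 2 ≤ n) (u v G r : ℝ) (hr : 0 < r) (hr1 : r < 1)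
    (hG : |v| ≤ G) :
    r ^ (n - 1) * ((((n : ℝ) - 1) / n) ^ n * (|u| ^ n / (r ^ n * Real.log (1 / r) ^ n)) - G ^ n)
      ≤ (((n : ℝ) - 1) / n) ^ (n - 1) * ((n * |u| ^ (n - 2) * u * v) / (-Real.log r) ^ (n - 1)
        + (n - 1) * |u| ^ n / ((-Real.log r) ^ n * r)) := by
  have hL : 0 < -Real.log r := by have := Real.log_neg hr hr1; linarith
  rw [one_div, Real.log_inv]
  generalize -Real.log r = L at *
  have hc : 0 < ((n : ℝ) - 1) / n := by
    have : (2 : ℝ) ≤ n := by exact_mod_cast hn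
    apply div_pos <;> linarith
  have hnc : (n : ℝ) * (((n : ℝ) - 1) / n) = n - 1 := by
    have : (n : ℝ) ≠ 0 := by positivity
    field_simp
  generalize ((n : ℝ) - 1) / n = c at *
  have hy := ch_young n (by omega) (c * |u| / L) (r * |v|) (by positivity) (by positivity)
  have hGn : |v| ^ n ≤ G ^ n := by gcongr
  have huv : -(|u| * |v|) ≤ u * v := by rw [← abs_mul]; exact neg_abs_le _
  rw [← hnc] at hy ⊢
  obtain ⟨m, rfl⟩ : ∃ m, n = m + 2 := ⟨n - 2, by omega⟩
  simp only [Nat.add_sub_cancel, show m + 2 - 1 = m + 1 by omega] at *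
  have hN : (0 : ℝ) ≤ ((m + 2 : ℕ) : ℝ) := by positivity
  generalize ((m + 2 : ℕ) : ℝ) = N at *
  calc r ^ (m + 1) * (c ^ (m + 2) * (|u| ^ (m + 2) / (r ^ (m + 2) * L ^ (m + 2))) - G ^ (m + 2))
      ≤ r ^ (m + 1) * (c ^ (m + 2) * (|u| ^ (m + 2) / (r ^ (m + 2) * L ^ (m + 2))) - |v| ^ (m + 2)) := by
        gcongr
    _ = ((c * |u| / L) ^ (m + 2) - (r * |v|) ^ (m + 2)) / r := by
        rw [div_pow, mul_pow, mul_pow]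
        field_simp
        ring
    _ ≤ (N * c * (c * |u| / L) ^ (m + 2) + (c * |u| / L) ^ (m + 2)
          - N * (c * |u| / L) ^ (m + 1) * (r * |v|)) / r := by
        apply div_le_div_of_nonneg_right _ hr.le
        linarith
    _ = c ^ (m + 1) * ((N * |u| ^ m * (-(|u| * |v|))) / L ^ (m + 1) +
          N * c * |u| ^ (m + 2) / (L ^ (m + 2) * r)) := by
        have e : N * c * (c * |u| / L) ^ (m + 2) + (c * |u| / L) ^ (m + 2)
            = N * (c * |u| / L) ^ (m + 2) := by rw [hnc]; ring
        rw [e, div_pow, div_pow, mul_pow, mul_pow]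
        field_simp
        ring
    _ ≤ _ := by
        have : N * |u| ^ m * (-(|u| * |v|)) ≤ N * |u| ^ m * u * v := by
          rw [mul_assoc _ u v]; gcongr
        gcongr

lemma ch_one (n : ℕ) (hn : 2 ≤ n) (u v G : ℝ → ℝ) (R : ℝ) (hR : 0 < R) (hR1 : R < 1)
    (hu : ∀ r, 0 < r → HasDerivAt u (v r) r) (hG : ∀ r, 0 < r → |v r| ≤ G r)
    (hz : ∀ r, R ≤ r → u r = 0) :
    ∫ r in Set.Ioi (0 : ℝ), r ^ (n - 1) * ((((n : ℝ) - 1) / n) ^ n *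
      (|u r| ^ n / (r ^ n * Real.log (1 / r) ^ n)) - G r ^ n) ≤ 0 := by
  set φ : ℝ → ℝ := fun r => r ^ (n - 1) * ((((n : ℝ) - 1) / n) ^ n *
      (|u r| ^ n / (r ^ n * Real.log (1 / r) ^ n)) - G r ^ n) with hφ
  by_cases hi : IntegrableOn φ (Set.Ioi 0)
  swap
  · rw [integral_undef hi]
  have hn0 : n ≠ 0 := by omega
  have hc : 0 < ((n : ℝ) - 1) / n := by
    have : (2 : ℝ) ≤ n := by exact_mod_cast hn
    apply div_pos <;> linarith
  have hi1 : IntegrableOn φ (Set.Ioc 0 R) := hi.mono_set Set.Ioc_subset_Ioi_self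
  have hi2 : IntegrableOn φ (Set.Ioi R) := hi.mono_set (Set.Ioi_subset_Ioi hR.le)
  rw [← Set.Ioc_union_Ioi_eq_Ioi hR.le, setIntegral_union (Set.Ioc_disjoint_Ioi le_rfl)
    measurableSet_Ioi hi1 hi2]
  have h2 : ∫ r in Set.Ioi R, φ r ≤ 0 := by
    apply setIntegral_nonpos measurableSet_Ioi
    intro r hr
    have hr0 : 0 < r := hR.trans hr
    have hG0 : 0 ≤ G r := (abs_nonneg _).trans (hG r hr0)
    simp only [hφ, hz r (le_of_lt hr), abs_zero, zero_pow hn0, zero_div, mul_zero, zero_sub]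
    have : 0 ≤ r ^ (n - 1) * G r ^ n := by positivity
    linarith
  have h1 : ∫ r in Set.Ioc 0 R, φ r ≤ 0 := by
    have hcov := aecover_Ioc_of_Ioc (μ := volume) (l := nhdsWithin (0 : ℝ) (Set.Ioi 0))
      (a := id) (b := fun _ => R) (A := 0) (B := R)
      (tendsto_nhdsWithin_of_tendsto_nhds Filter.tendsto_id) tendsto_const_nhds
    refine le_of_tendsto (hcov.integral_tendsto_of_countably_generated hi1) ?_
    filter_upwards [Ioo_mem_nhdsGT hR] with ε hε
    rw [Measure.restrict_restrict measurableSet_Ioc]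
    have e : Set.Ioc (id ε) R ∩ Set.Ioc 0 R = Set.Ioc ε R := by
      apply Set.inter_eq_left.2
      exact Set.Ioc_subset_Ioc_left hε.1.le
    rw [e, ← intervalIntegral.integral_of_le hε.2.le]
    have hd : ∀ x ∈ Set.Icc ε R, HasDerivAt (fun r => (((n : ℝ) - 1) / n) ^ (n - 1) *
        (|u r| ^ n / (-Real.log r) ^ (n - 1))) _ x := fun x hx =>
      (ch_deriv n hn u (v x) x (hε.1.trans_le hx.1) (hx.2.trans_lt hR1)
        (hu x (hε.1.trans_le hx.1))).const_mul _
    have := intervalIntegral.integral_le_sub_of_hasDeriv_right_of_le (φ := φ) hε.2.le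
      (fun x hx => (hd x hx).continuousAt.continuousWithinAt)
      (fun x hx => (hd x (Set.Ioo_subset_Icc_self hx)).hasDerivWithinAt)
      (hi.mono_set fun x hx => hε.1.trans_le hx.1)
      (fun x hx => ch_pointwise n hn (u x) (v x) (G x) x (hε.1.trans hx.1) (hx.2.trans hR1)
        (hG x (hε.1.trans hx.1)))
    refine this.trans ?_
    have hL : 0 < -Real.log ε := by have := Real.log_neg hε.1 (hε.2.trans hR1); linarith
    simp only [hz R le_rfl, abs_zero, zero_pow hn0, zero_div, mul_zero, zero_sub]
    have : 0 ≤ (((n : ℝ) - 1) / n) ^ (n - 1) * (|u ε| ^ n / (-Real.log ε) ^ (n - 1)) := by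
      positivity
    linarith
  linarith

lemma ch_polar {E : Type*} [NormedAddCommGroup E] [NormedSpace ℝ E] [FiniteDimensional ℝ E]
    [MeasurableSpace E] [BorelSpace E] [Nontrivial E] (μ : Measure E) [μ.IsAddHaarMeasure]
    (D : E → ℝ) (hD : Integrable D μ)
    (h : ∀ θ : E, ‖θ‖ = 1 →
      ∫ r in Set.Ioi (0 : ℝ), r ^ (Module.finrank ℝ E - 1) * D (r • θ) ≤ 0) :
    ∫ x, D x ∂μ ≤ 0 := by
  have hmp := μ.measurePreserving_homeomorphUnitSphereProd
  set g : Metric.sphere (0 : E) 1 × Set.Ioi (0 : ℝ) → ℝ := fun p => D (p.2.1 • p.1.1) with hg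
  have hgc : ∀ x : ({0}ᶜ : Set E), g (homeomorphUnitSphereProd E x) = D x := by
    intro x
    have := congrArg Subtype.val ((homeomorphUnitSphereProd E).symm_apply_apply x)
    rw [homeomorphUnitSphereProd_symm_apply_coe] at this
    exact congrArg D this
  have e1 : ∫ x, D x ∂μ = ∫ p, g p ∂(μ.toSphere.prod (.volumeIoiPow (Module.finrank ℝ E - 1))) := by
    rw [← hmp.integral_comp (Homeomorph.measurableEmbedding _)]
    simp_rw [hgc]
    rw [integral_subtype_comap (measurableSet_singleton _).compl, restrict_compl_singleton]
  have e2 : Integrable g (μ.toSphere.prod (.volumeIoiPow (Module.finrank ℝ E - 1))) := by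
    rw [← hmp.integrable_comp_emb (Homeomorph.measurableEmbedding _)]
    have : g ∘ (homeomorphUnitSphereProd E) = D ∘ Subtype.val := by
      ext x; exact hgc x
    rw [this, ← integrableOn_iff_comap_subtypeVal (measurableSet_singleton _).compl]
    exact hD.integrableOn
  rw [e1, integral_prod _ e2]
  apply integral_nonpos
  intro θ
  have := h θ.1 (by simp)
  refine le_trans (le_of_eq ?_) this
  simp only [Measure.volumeIoiPow, ENNReal.ofReal, hg]
  rw [integral_withDensity_eq_integral_smul,
    integral_subtype_comap measurableSet_Ioi
      fun a : ℝ ↦ Real.toNNReal (a ^ (Module.finrank ℝ E - 1)) • D (a • θ.1),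
    setIntegral_congr_fun measurableSet_Ioi fun x hx ↦ ?_]
  · rw [NNReal.smul_def, Real.coe_toNNReal _ (pow_nonneg hx.out.le _), smul_eq_mul]
  · exact (measurable_subtype_coe.pow_const _).real_toNNReal

/-- Euclidean case `p = n` of Corollary 3.7: the critical Hardy inequality of
Ioku–Ishiwata type for the full gradient. -/
theorem critical_hardy_gradient (n : ℕ) (hn : 2 ≤ n)
    (f : EuclideanSpace ℝ (Fin n) → ℝ) (hf : ContDiff ℝ (⊤ : ℕ∞) f) (hfc : HasCompactSupport f)
    (hsupp : tsupport f ⊆ Metric.ball (0 : EuclideanSpace ℝ (Fin n)) 1) :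
    (((n : ℝ) - 1) / n) ^ (n : ℝ) *
        ∫ x in Metric.ball (0 : EuclideanSpace ℝ (Fin n)) 1,
          |f x| ^ (n : ℝ) / (‖x‖ ^ (n : ℝ) * Real.log (1 / ‖x‖) ^ (n : ℝ)) ≤
      ∫ x in Metric.ball (0 : EuclideanSpace ℝ (Fin n)) 1, ‖gradient f x‖ ^ (n : ℝ) := by
  simp only [Real.rpow_natCast]
  have hn0 : n ≠ 0 := by omega
  have hgn : ∀ x, ‖gradient f x‖ = ‖fderiv ℝ f x‖ := fun x => by simp [gradient]
  simp only [hgn]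
  obtain ⟨R, ⟨hR, hR1⟩, hRs⟩ := exists_pos_lt_subset_ball one_pos (isClosed_tsupport f) hsupp
  have hfz : ∀ x, R ≤ ‖x‖ → f x = 0 := by
    intro x hx
    apply image_eq_zero_of_notMem_tsupport
    intro h
    have := hRs h
    rw [mem_ball_zero_iff] at this
    linarith
  have hdz : ∀ x, x ∉ Metric.ball (0 : EuclideanSpace ℝ (Fin n)) 1 → fderiv ℝ f x = 0 := by
    intro x hx
    by_contra h
    exact hx (hsupp (support_fderiv_subset ℝ h))
  rw [setIntegral_eq_integral_of_forall_compl_eq_zero, setIntegral_eq_integral_of_forall_compl_eq_zero]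
  rotate_left
  · intro x hx
    simp [hdz x hx, hn0]
  · intro x hx
    have : 1 ≤ ‖x‖ := by simpa using hx
    simp [hfz x (by linarith), hn0]
  set A : EuclideanSpace ℝ (Fin n) → ℝ := fun x => |f x| ^ n / (‖x‖ ^ n * Real.log (1 / ‖x‖) ^ n)
  by_cases hA : Integrable A
  swap
  · rw [integral_undef hA, mul_zero]
    positivity
  have hB : Integrable (fun x => ‖fderiv ℝ f x‖ ^ n) := by
    apply Continuous.integrable_of_hasCompactSupport
    · exact ((hf.continuous_fderiv (by simp)).norm).pow n
    · exact (hfc.fderiv ℝ).comp_left (g := fun y => ‖y‖ ^ n) (by simp [hn0])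
  have : Nontrivial (EuclideanSpace ℝ (Fin n)) := by
    have : Nonempty (Fin n) := ⟨⟨0, by omega⟩⟩
    infer_instance
  have key := ch_polar volume (fun x => (((n : ℝ) - 1) / n) ^ n * A x - ‖fderiv ℝ f x‖ ^ n)
    ((hA.const_mul _).sub hB) ?_
  · rw [integral_sub (hA.const_mul _) hB, integral_const_mul] at key
    linarith
  intro θ hθ
  have hnorm : ∀ r : ℝ, ‖r • θ‖ = |r| := fun r => by rw [norm_smul, hθ, mul_one, Real.norm_eq_abs]
  have h1 := ch_one n hn (fun r => f (r • θ)) (fun r => fderiv ℝ f (r • θ) θ)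
    (fun r => ‖fderiv ℝ f (r • θ)‖) R hR hR1 ?_ ?_ ?_
  · refine le_trans (le_of_eq ?_) h1
    rw [finrank_euclideanSpace_fin]
    apply setIntegral_congr_fun measurableSet_Ioi
    intro r hr
    simp only [A, hnorm, abs_of_pos hr.out]
  · intro r _
    have hd := ((hf.differentiable (by simp)) (r • θ)).hasFDerivAt
    have h2 : HasDerivAt (fun r : ℝ => r • θ) θ r := by
      simpa using (hasDerivAt_id r).smul_const θ
    exact hd.comp_hasDerivAt r h2
  · intro r _
    have := (fderiv ℝ f (r • θ)).le_opNorm θ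
    rwa [hθ, mul_one, Real.norm_eq_abs] at this
  · intro r hr
    apply hfz
    rw [hnorm]
    exact hr.trans (le_abs_self r)
end

section
/- Let n ≥ 2 be an integer, p ∈ (1, n) and −n(p−1) < β < n − p. Then for every f ∈ C_c^∞(ℝ^n), ∫_{ℝ^n} |f(x)|^p / |x|^{p+β} dx ≤ (p/(n(p−1)+β))^p ∫_{ℝ^n} | ∂_r f(x) + ((n−1)/|x|) f(x) |^p / |x|^β dx. -/
open MeasureTheory

/-- A bounded measurable function supported in a ball is integrable against `‖x‖ ^ (-s)`. -/
lemma integrable_mul_weight {n : ℕ} (hn : 2 ≤ n) {s : ℝ} (hs : s < n) {M R : ℝ}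
    {g : EuclideanSpace ℝ (Fin n) → ℝ} (hg : Measurable g) (hM : ∀ x, |g x| ≤ M)
    (hR : ∀ x, R ≤ ‖x‖ → g x = 0) : Integrable (fun x => g x * ‖x‖ ^ (-s)) := by
  have hm : Measurable fun x : EuclideanSpace ℝ (Fin n) => g x * ‖x‖ ^ (-s) := by fun_prop
  have h := integrableOn_ball_of_norm_le_rpow (E := EuclideanSpace ℝ (Fin n)) (μ := volume)
    (f := fun x => g x * ‖x‖ ^ (-s)) (C := M) (α := s) (r := R) (by simp; omega) (by simpa using hs)
    (Filter.Eventually.of_forall fun x => by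
      have h0 : 0 ≤ ‖x‖ ^ (-s) := by positivity
      simp only [Real.norm_eq_abs, abs_mul, abs_of_nonneg h0]
      exact mul_le_mul_of_nonneg_right (hM x) h0) hm.aestronglyMeasurable
  refine (integrableOn_iff_integrable_of_support_subset ?_).1 h
  intro x hx
  by_contra hc
  simp only [Metric.mem_ball, dist_zero_right, not_lt] at hc
  exact hx (by simp [hR x hc])

/-- A continuous compactly supported real function is bounded and vanishes outside a ball. -/
lemma exists_bounds {n : ℕ} {F : Type*} [NormedAddCommGroup F]
    {g : EuclideanSpace ℝ (Fin n) → F} (hg : Continuous g)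
    (hc : HasCompactSupport g) : ∃ M R : ℝ, 0 ≤ M ∧ 0 < R ∧ (∀ x, ‖g x‖ ≤ M) ∧
      ∀ x, R ≤ ‖x‖ → g x = 0 := by
  obtain ⟨M, hM⟩ := hg.bounded_above_of_compact_support hc
  obtain ⟨R, hR0, hR⟩ := hc.isCompact.isBounded.exists_pos_norm_lt
  refine ⟨M, R, (norm_nonneg _).trans (hM 0), hR0, hM, fun x hx => ?_⟩
  by_contra h
  exact absurd (hR x (subset_tsupport g h)) (not_lt.2 hx)

/-- Euler identity from scaling. -/
lemma euler_identity {n : ℕ} (hn : 2 ≤ n) {s : ℝ} (hs : s < n)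
    {φ : EuclideanSpace ℝ (Fin n) → ℝ} (hφ : ContDiff ℝ 1 φ) (hc : HasCompactSupport φ) :
    Integrable (fun x => fderiv ℝ φ x x * ‖x‖ ^ (-s)) ∧
    ∫ x, fderiv ℝ φ x x * ‖x‖ ^ (-s) = (s - n) * ∫ x, φ x * ‖x‖ ^ (-s) := by
  have hdc : Continuous (fderiv ℝ φ) := hφ.continuous_fderiv one_ne_zero
  obtain ⟨M, R, hM0, hR0, hM, hR⟩ := exists_bounds hφ.continuous hc
  obtain ⟨M', R', hM'0, hR'0, hM', hR'⟩ := exists_bounds hdc (hc.fderiv (𝕜 := ℝ))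
  have key := hasDerivAt_integral_of_dominated_loc_of_deriv_le (μ := volume) (𝕜 := ℝ)
    (F := fun (t : ℝ) (x : EuclideanSpace ℝ (Fin n)) => φ (t • x) * ‖x‖ ^ (-s))
    (F' := fun (t : ℝ) (x : EuclideanSpace ℝ (Fin n)) => fderiv ℝ φ (t • x) x * ‖x‖ ^ (-s))
    (x₀ := 1) (s := Set.Ioo (1/2) 2)
    (bound := fun x => (Metric.ball (0 : EuclideanSpace ℝ (Fin n)) (2 * R')).indicator
      (fun _ => M' * (2 * R')) x * ‖x‖ ^ (-s))
    (Ioo_mem_nhds (by norm_num) (by norm_num))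
    (Filter.Eventually.of_forall fun t => by
      have := hφ.continuous.measurable
      exact Measurable.aestronglyMeasurable (by fun_prop))
    (by
      simp only [one_smul]
      exact integrable_mul_weight hn hs hφ.continuous.measurable hM hR)
    (by
      have h1 : Continuous fun x : EuclideanSpace ℝ (Fin n) => fderiv ℝ φ ((1:ℝ) • x) x := by
        fun_prop
      have := h1.measurable
      exact Measurable.aestronglyMeasurable (by fun_prop))
    (Filter.Eventually.of_forall fun x t ht => by
      have h0 : 0 ≤ ‖x‖ ^ (-s) := by positivity
      rw [norm_mul, Real.norm_of_nonneg h0]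
      refine mul_le_mul_of_nonneg_right ?_ h0
      by_cases hx : x ∈ Metric.ball (0 : EuclideanSpace ℝ (Fin n)) (2 * R')
      · rw [Set.indicator_of_mem hx]
        simp only [Metric.mem_ball, dist_zero_right] at hx
        exact (ContinuousLinearMap.le_opNorm _ _).trans
          (mul_le_mul (hM' _) hx.le (norm_nonneg _) hM'0)
      · rw [Set.indicator_of_notMem hx]
        simp only [Metric.mem_ball, dist_zero_right, not_lt] at hx
        rw [hR' (t • x) ?_]
        · simp
        · rw [norm_smul, Real.norm_of_nonneg (by linarith [ht.1])]
          nlinarith [ht.1])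
    (by
      refine integrable_mul_weight (M := M' * (2 * R')) (R := 2 * R') hn hs ?_ ?_ ?_
      · exact measurable_const.indicator measurableSet_ball
      · intro x
        have : 0 ≤ M' * (2 * R') := by positivity
        by_cases hx : x ∈ Metric.ball (0 : EuclideanSpace ℝ (Fin n)) (2 * R')
        · simp only [Set.indicator_of_mem hx, abs_of_nonneg this, le_refl]
        · simpa only [Set.indicator_of_notMem hx, abs_zero]
      · intro x hx
        exact Set.indicator_of_notMem (by simpa using hx) _)
    (Filter.Eventually.of_forall fun x t ht => by
      have h1 : HasDerivAt (fun t : ℝ => t • x) x t := by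
        simpa using (hasDerivAt_id t).smul_const x
      have h2 := ((hφ.differentiable one_ne_zero) (t • x)).hasFDerivAt.comp_hasDerivAt t h1
      exact h2.mul_const _)
  obtain ⟨k1, k2⟩ := key
  simp only [one_smul] at k1 k2
  refine ⟨k1, ?_⟩
  have hsc : HasDerivAt (fun t : ℝ => t ^ (s - n) * ∫ x, φ x * ‖x‖ ^ (-s))
      ((s - n) * ∫ x, φ x * ‖x‖ ^ (-s)) 1 := by
    have := (Real.hasDerivAt_rpow_const (x := 1) (p := s - n) (Or.inl one_ne_zero)).mul_const
      (∫ x, φ x * ‖x‖ ^ (-s))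
    simpa using this
  refine (k2.congr_of_eventuallyEq ?_).unique hsc |>.symm ▸ rfl
  filter_upwards [lt_mem_nhds (show (0:ℝ) < 1 by norm_num)] with t ht
  have h1 := Measure.integral_comp_smul_of_nonneg (volume : Measure (EuclideanSpace ℝ (Fin n)))
    (fun x => φ x * ‖x‖ ^ (-s)) t (hR := ht.le)
  have h2 : ∀ x : EuclideanSpace ℝ (Fin n), φ (t • x) * ‖x‖ ^ (-s)
      = t ^ s * (φ (t • x) * ‖t • x‖ ^ (-s)) := by
    intro x
    rw [norm_smul, Real.norm_of_nonneg ht.le, Real.mul_rpow ht.le (norm_nonneg _),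
      Real.rpow_neg ht.le]
    have : t ^ s ≠ 0 := (Real.rpow_pos_of_pos ht s).ne'
    field_simp
  simp_rw [h2]
  rw [integral_const_mul, h1, Real.rpow_sub ht, Real.rpow_natCast]
  simp only [finrank_euclideanSpace, Fintype.card_fin, smul_eq_mul]
  ring

lemma young_aux {p l a b : ℝ} (hp : 1 < p) (hl : 0 < l) :
    p * |a| ^ (p - 2) * a * b ≤ (p - 1) * l * |a| ^ p + l ^ (1 - p) * |b| ^ p := by
  have hpq : p.HolderConjugate (p / (p - 1)) := Real.HolderConjugate.conjExponent hp
  have h := Real.young_inequality_of_nonneg (abs_nonneg b)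
    (b := (l * |a|) ^ (p - 1)) (by positivity) hpq
  have hp1 : p - 1 ≠ 0 := by linarith
  have hp0 : 0 < p := by linarith
  rw [← Real.rpow_mul (by positivity), mul_div_cancel₀ _ hp1,
    Real.mul_rpow hl.le (abs_nonneg _), Real.mul_rpow hl.le (abs_nonneg _)] at h
  have e1 : l ^ (1 - p) * l ^ (p - 1) = 1 := by
    rw [← Real.rpow_add hl]; simp
  have e2 : l ^ (1 - p) * l ^ p = l := by
    rw [← Real.rpow_add hl]; simp
  have h2 := mul_le_mul_of_nonneg_left h
    (show 0 ≤ p * l ^ (1 - p) by positivity)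
  have e3 : p * l ^ (1 - p) * (|b| * (l ^ (p - 1) * |a| ^ (p - 1))) = p * |a| ^ (p - 1) * |b| := by
    linear_combination (p * |a| ^ (p - 1) * |b|) * e1
  have e4 : p * l ^ (1 - p) * (|b| ^ p / p + l ^ p * |a| ^ p / (p / (p - 1)))
      = (p - 1) * l * |a| ^ p + l ^ (1 - p) * |b| ^ p := by
    field_simp
    linear_combination ((p - 1) * |a| ^ p) * e2
  rw [e3, e4] at h2
  refine le_trans ?_ h2
  by_cases ha : a = 0
  · subst ha
    simp [Real.zero_rpow hp1]
  · have : |a| ^ (p - 1) = |a| ^ (p - 2) * |a| := by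
      rw [← Real.rpow_add_one (abs_ne_zero.2 ha)]; congr 1; ring
    rw [this]
    have hab : a * b ≤ |a| * |b| := by rw [← abs_mul]; exact le_abs_self _
    have := mul_le_mul_of_nonneg_left hab (show 0 ≤ p * |a| ^ (p - 2) by positivity)
    linarith

/-- Euclidean case of Lemma 4.1. -/
theorem hardy_radial_onetwo (n : ℕ) (hn : 2 ≤ n) (p β : ℝ) (hp1 : 1 < p) (hpn : p < n)
    (hβl : -(n * (p - 1)) < β) (hβu : β < n - p)
    (f : EuclideanSpace ℝ (Fin n) → ℝ) (hf : ContDiff ℝ (⊤ : ℕ∞) f) (hfc : HasCompactSupport f) :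
    ∫ x : EuclideanSpace ℝ (Fin n), |f x| ^ p / ‖x‖ ^ (p + β) ≤
      (p / (n * (p - 1) + β)) ^ p *
        ∫ x : EuclideanSpace ℝ (Fin n),
          |radDeriv f x + ((n : ℝ) - 1) / ‖x‖ * f x| ^ p / ‖x‖ ^ β := by
  have hp0 : 0 < p := by linarith
  have hs : p + β < n := by linarith
  have hf1 : ContDiff ℝ 1 f := hf.of_le (by exact_mod_cast le_top)
  have hdc : Continuous (fderiv ℝ f) := hf1.continuous_fderiv one_ne_zero
  set b : EuclideanSpace ℝ (Fin n) → ℝ := fun x => fderiv ℝ f x x + ((n : ℝ) - 1) * f x with hb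
  have hbc : Continuous b := by have := hf1.continuous; fun_prop
  have hbs : HasCompactSupport b := by
    refine hfc.mono' (fun x hx => ?_)
    by_contra h
    have h1 : f x = 0 := image_eq_zero_of_notMem_tsupport h
    have h2 : fderiv ℝ f x = 0 := by
      by_contra h3
      exact h (support_fderiv_subset ℝ h3)
    exact hx (by simp [hb, h1, h2])
  have hφ : ContDiff ℝ 1 (fun x => |f x| ^ p) := by
    have := (contDiff_norm_rpow (E := ℝ) hp1).comp hf1
    exact this
  have hφs : HasCompactSupport (fun x => |f x| ^ p) := by
    have := hfc.comp_left (g := fun y : ℝ => |y| ^ p) (by simp [Real.zero_rpow hp0.ne'])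
    exact this
  have hψc : Continuous (fun x => |b x| ^ p) := hbc.abs.rpow_const fun _ => Or.inr hp0.le
  have hψs : HasCompactSupport (fun x => |b x| ^ p) := by
    have := hbs.comp_left (g := fun y : ℝ => |y| ^ p) (by simp [Real.zero_rpow hp0.ne'])
    exact this
  obtain ⟨iX, eX⟩ := euler_identity hn hs hφ hφs
  obtain ⟨M, R, -, -, hM, hR⟩ := exists_bounds hφ.continuous hφs
  have iG := integrable_mul_weight hn hs hφ.continuous.measurable hM hR
  obtain ⟨M', R', -, -, hM', hR'⟩ := exists_bounds hψc hψs
  have iK := integrable_mul_weight hn hs hψc.measurable hM' hR'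
  have hL : ∫ x : EuclideanSpace ℝ (Fin n), |f x| ^ p / ‖x‖ ^ (p + β)
      = ∫ x : EuclideanSpace ℝ (Fin n), |f x| ^ p * ‖x‖ ^ (-(p + β)) := by
    refine integral_congr_ae (Filter.Eventually.of_forall fun x => ?_)
    simp only [Real.rpow_neg (norm_nonneg x), div_eq_mul_inv]
  have : Nonempty (Fin n) := ⟨⟨0, by omega⟩⟩
  have hRt : ∫ x : EuclideanSpace ℝ (Fin n),
      |radDeriv f x + ((n : ℝ) - 1) / ‖x‖ * f x| ^ p / ‖x‖ ^ β
      = ∫ x : EuclideanSpace ℝ (Fin n), |b x| ^ p * ‖x‖ ^ (-(p + β)) := by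
    refine integral_congr_ae ?_
    filter_upwards [Measure.ae_ne volume (0 : EuclideanSpace ℝ (Fin n))] with x hx
    have hx0 : 0 < ‖x‖ := norm_pos_iff.2 hx
    have h1 : radDeriv f x + ((n : ℝ) - 1) / ‖x‖ * f x = ‖x‖⁻¹ * b x := by
      simp only [radDeriv, hb, map_smul, smul_eq_mul]
      ring
    rw [h1, abs_mul, abs_of_pos (inv_pos.2 hx0),
      Real.mul_rpow (inv_pos.2 hx0).le (abs_nonneg _), Real.inv_rpow hx0.le,
      Real.rpow_neg hx0.le, Real.rpow_add hx0]
    field_simp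
  rw [hL, hRt]
  set I := ∫ x : EuclideanSpace ℝ (Fin n), |f x| ^ p * ‖x‖ ^ (-(p + β)) with hI
  set K := ∫ x : EuclideanSpace ℝ (Fin n), |b x| ^ p * ‖x‖ ^ (-(p + β)) with hK
  have hC : 0 < n * (p - 1) + β := by linarith
  set l := (n * (p - 1) + β) / p with hl
  have hl0 : 0 < l := by positivity
  have hmain : (p + β - n) * I ≤ ((p - 1) * l - p * (n - 1)) * I + l ^ (1 - p) * K := by
    rw [← eX, hI, hK, ← integral_const_mul, ← integral_const_mul,
      ← integral_add (iG.const_mul _) (iK.const_mul _)]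
    refine integral_mono iX ((iG.const_mul _).add (iK.const_mul _)) fun x => ?_
    have h0 : 0 ≤ ‖x‖ ^ (-(p + β)) := by positivity
    have hd : fderiv ℝ (fun x => |f x| ^ p) x x = p * |f x| ^ (p - 2) * f x * fderiv ℝ f x x := by
      have := (hasDerivAt_abs_rpow (f x) hp1).comp_hasFDerivAt x
        (hf1.differentiable one_ne_zero x).hasFDerivAt
      have h2 := this.fderiv
      simp only [Function.comp_def] at h2
      rw [h2]
      simp
    have hy := young_aux (a := f x) (b := b x) hp1 hl0
    have ha : p * |f x| ^ (p - 2) * f x * f x = p * |f x| ^ p := by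
      by_cases ha : f x = 0
      · simp [ha, Real.zero_rpow hp0.ne']
      · have : |f x| ^ p = |f x| ^ (p - 2) * |f x| ^ (2 : ℕ) := by
          rw [← Real.rpow_add_natCast (abs_ne_zero.2 ha)]; congr 1; push_cast; ring
        rw [this, sq_abs]; ring
    have h3 : fderiv ℝ (fun x => |f x| ^ p) x x ≤
        ((p - 1) * l - p * (n - 1)) * |f x| ^ p + l ^ (1 - p) * |b x| ^ p := by
      rw [hd]
      simp only [hb] at hy ⊢
      linear_combination hy - (n - 1 : ℝ) * ha
    have := mul_le_mul_of_nonneg_right h3 h0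
    simp only
    linarith
  have hpl : p * l = n * (p - 1) + β := by rw [hl]; field_simp
  have h1 : l * I ≤ l ^ (1 - p) * K := by
    linear_combination hmain + (I) * hpl
  have h2 : (p / (n * (p - 1) + β)) ^ p = l ^ (-p) := by
    rw [hl, Real.rpow_neg hl0.le, ← Real.inv_rpow hl0.le, inv_div]
  have h3 : l ^ (1 - p) = l * l ^ (-p) := by
    rw [sub_eq_add_neg, Real.rpow_add hl0, Real.rpow_one]
  rw [h2]
  rw [h3, mul_assoc] at h1
  exact le_of_mul_le_mul_left h1 hl0
end

section
/- Let n ≥ 3 be an integer and p ∈ (1, n). Then for every f ∈ C_c^∞(B), ∫_B |f(x)|^p / ( |x|^n (log(1/|x|))^p ) dx ≤ ( p/((p−1)(n−2)) )^p ∫_B |Δ_r f(x)|^p / |x|^{n−2p} dx. -/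
open MeasureTheory

/-- The radial Laplacian `Δ_r f = ∂_r² f + ((n-1)/|x|) ∂_r f`. -/
noncomputable def radLap {n : ℕ} (f : EuclideanSpace ℝ (Fin n) → ℝ)
    (x : EuclideanSpace ℝ (Fin n)) : ℝ :=
  radDeriv (radDeriv f) x + ((n : ℝ) - 1) / ‖x‖ * radDeriv f x


lemma crr_young (p x y : ℝ) (hp : 1 < p) (hx : 0 ≤ x) (hy : 0 ≤ y) :
    p * (x ^ (p - 1) * y) ≤ (p - 1) * x ^ p + y ^ p := by
  have hp0 : 0 < p := by linarith
  have hp1 : 0 < p - 1 := by linarith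
  have h := Real.geom_mean_le_arith_mean2_weighted (w₁ := (p - 1) / p) (w₂ := 1 / p)
    (p₁ := x ^ p) (p₂ := y ^ p) (by positivity) (by positivity) (by positivity) (by positivity)
    (by field_simp; ring)
  rw [← Real.rpow_mul hx, ← Real.rpow_mul hy, mul_div_cancel₀ _ hp0.ne',
    mul_one_div_cancel hp0.ne', Real.rpow_one] at h
  calc p * (x ^ (p - 1) * y) ≤ p * ((p - 1) / p * x ^ p + 1 / p * y ^ p) := by gcongr
    _ = _ := by field_simp

lemma crr_abs (p u v : ℝ) : |(|u| ^ (p - 2) * u * v)| = |u| ^ (p - 2) * |u| * |v| := by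
  rw [abs_mul, abs_mul, abs_of_nonneg (a := |u| ^ (p - 2)) (by positivity)]

lemma crr_pow1 (p u : ℝ) (hp : 1 < p) : |u| ^ (p - 2) * |u| = |u| ^ (p - 1) := by
  rcases eq_or_ne u 0 with rfl | hu
  · simp [Real.zero_rpow (by linarith : p - 1 ≠ 0)]
  · have : 0 < |u| := abs_pos.mpr hu
    nth_rw 2 [← Real.rpow_one |u|]
    rw [← Real.rpow_add this]; congr 1; ring

lemma crr_pow2 (p u : ℝ) (hp : 1 < p) : |u| ^ (p - 2) * u * u = |u| ^ p := by
  rw [mul_assoc, ← abs_mul_abs_self u, ← mul_assoc, crr_pow1 p u hp]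
  nth_rw 2 [← Real.rpow_one |u|]
  rw [← Real.rpow_add' (abs_nonneg u) (by linarith)]; congr 1; ring

lemma crr_part1 (p r L u v : ℝ) (hp : 1 < p) (hr : 0 < r) (hL : 0 < L) :
    |u| ^ p / L ^ p / r - (p / (p - 1)) ^ p * (|v| ^ p * r ^ (p - 1)) ≤
      p * ((p * |u| ^ (p - 2) * u * v) * (L ^ (1 - p) / (p - 1)) + |u| ^ p * (L ^ (-p) / r)) := by
  have hp1 : 0 < p - 1 := by linarith
  have hp0 : 0 < p := by linarith
  have hY := crr_young p (|u| / L) (p / (p - 1) * (r * |v|)) hp (by positivity) (by positivity)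
  rw [Real.div_rpow (abs_nonneg u) hL.le, Real.div_rpow (abs_nonneg u) hL.le,
    Real.mul_rpow (by positivity) (by positivity), Real.mul_rpow hr.le (abs_nonneg v)] at hY
  have h1 : -(|u| ^ (p - 1) * |v|) ≤ |u| ^ (p - 2) * u * v := by
    rw [← crr_pow1 p u hp, ← crr_abs]; exact neg_abs_le _
  have e1 : L ^ (1 - p) = 1 / L ^ (p - 1) := by
    rw [show 1 - p = -(p - 1) by ring, Real.rpow_neg hL.le, one_div]
  have e2 : L ^ (-p) = 1 / L ^ p := by rw [Real.rpow_neg hL.le, one_div]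
  have e3 : r ^ p = r ^ (p - 1) * r := by
    nth_rw 3 [← Real.rpow_one r]; rw [← Real.rpow_add hr]; congr 1; ring
  have hLp : 0 < L ^ (p - 1) := by positivity
  have hLq : 0 < L ^ p := by positivity
  rw [e1, e2]
  rw [e3] at hY
  have h2 := mul_le_mul_of_nonneg_left h1 (by positivity : 0 ≤ p * p * (1 / L ^ (p - 1) / (p - 1)))
  have h3 := mul_le_mul_of_nonneg_left hY (by positivity : 0 ≤ 1 / r)
  have h4 : 1 / r * (p * (|u| ^ (p - 1) / L ^ (p - 1) * (p / (p - 1) * (r * |v|)))) =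
     p * p * (1 / L ^ (p - 1) / (p - 1)) * (|u| ^ (p - 1) * |v|) := by
    field_simp
  have h5 : 1 / r * ((p - 1) * (|u| ^ p / L ^ p) + (p / (p - 1)) ^ p * (r ^ (p - 1) * r * |v| ^ p))
     = (p - 1) * (|u| ^ p / L ^ p / r) + (p / (p - 1)) ^ p * (|v| ^ p * r ^ (p - 1)) := by
    field_simp
  rw [h4, h5] at h3
  have h6 : p * (p * |u| ^ (p - 2) * u * v * (1 / L ^ (p - 1) / (p - 1)) + |u| ^ p * (1 / L ^ p / r))
    = p * p * (1 / L ^ (p - 1) / (p - 1)) * (|u| ^ (p - 2) * u * v) + p * (|u| ^ p / L ^ p / r) := by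
    ring
  rw [h6]
  linarith

lemma crr_part2 (p m r v s : ℝ) (hp : 1 < p) (hm : 0 < m) (hr : 0 < r) :
    |v| ^ p * r ^ (p - 1) - (1 / m) ^ p * (|s + (m + 1) / r * v| ^ p * r ^ (2 * p - 1)) ≤
      -(1 / m * ((p * |v| ^ (p - 2) * v * s) * r ^ p + |v| ^ p * (p * r ^ (p - 1)))) := by
  have hp1 : 0 < p - 1 := by linarith
  have hp0 : 0 < p := by linarith
  obtain ⟨D, hD⟩ : ∃ D, D = s + (m + 1) / r * v := ⟨_, rfl⟩
  have hs : s = D - (m + 1) / r * v := by rw [hD]; ring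
  rw [← hD, hs]
  have hY := crr_young p (r * |v|) (1 / m * (r * r * |D|)) hp (by positivity) (by positivity)
  rw [Real.mul_rpow hr.le (abs_nonneg v), Real.mul_rpow hr.le (abs_nonneg v),
    Real.mul_rpow (by positivity) (by positivity), Real.mul_rpow (by positivity) (abs_nonneg D),
    Real.mul_rpow hr.le hr.le] at hY
  have h1 : |v| ^ (p - 2) * v * D ≤ |v| ^ (p - 1) * |D| := by
    rw [← crr_pow1 p v hp, ← crr_abs]; exact le_abs_self _
  have e3 : r ^ p = r ^ (p - 1) * r := by
    nth_rw 3 [← Real.rpow_one r]; rw [← Real.rpow_add hr]; congr 1; ring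
  have e4 : r ^ (2 * p - 1) = r ^ (p - 1) * r ^ (p - 1) * r := by
    nth_rw 4 [← Real.rpow_one r]; rw [← Real.rpow_add hr, ← Real.rpow_add hr]; congr 1; ring
  have e5 := crr_pow2 p v hp
  rw [e4, e3]
  rw [e3] at hY
  have hrp : 0 < r ^ (p - 1) := by positivity
  have h2 := mul_le_mul_of_nonneg_left h1 (by positivity : 0 ≤ p * (1 / m) * (r ^ (p - 1) * r))
  have h3 := mul_le_mul_of_nonneg_left hY (by positivity : 0 ≤ 1 / r)
  have h4 : 1 / r * (p * (r ^ (p - 1) * |v| ^ (p - 1) * (1 / m * (r * r * |D|)))) =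
     p * (1 / m) * (r ^ (p - 1) * r) * (|v| ^ (p - 1) * |D|) := by
    field_simp
  have h5 : 1 / r * ((p - 1) * (r ^ (p - 1) * r * |v| ^ p) +
      (1 / m) ^ p * (r ^ (p - 1) * r * (r ^ (p - 1) * r) * |D| ^ p))
     = (p - 1) * (|v| ^ p * r ^ (p - 1)) + (1 / m) ^ p * (|D| ^ p * (r ^ (p - 1) * r ^ (p - 1) * r)) := by
    field_simp
  rw [h4, h5] at h3
  have h6 : -(1 / m * (p * |v| ^ (p - 2) * v * (D - (m + 1) / r * v) * (r ^ (p - 1) * r) + |v| ^ p * (p * r ^ (p - 1))))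
    = p * (|v| ^ p * r ^ (p - 1)) - p * (1 / m) * (r ^ (p - 1) * r) * (|v| ^ (p - 2) * v * D) := by
    rw [← e5]; field_simp; ring
  rw [h6]
  linarith

lemma crr_oneD_abs (a b H H' : ℝ → ℝ) (R : ℝ) (hR0 : 0 < R) (hR1 : R < 1)
    (ha : ContinuousOn a (Set.Ioo 0 1)) (hb : ContinuousOn b (Set.Ioo 0 1))
    (ha0 : ∀ r ∈ Set.Ioo (0:ℝ) 1, 0 ≤ a r) (hb0 : ∀ r ∈ Set.Ioo (0:ℝ) 1, 0 ≤ b r)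
    (hH : ∀ r ∈ Set.Ioo (0:ℝ) 1, HasDerivAt H (H' r) r)
    (hle : ∀ r ∈ Set.Ioo (0:ℝ) 1, a r - b r ≤ H' r)
    (hHR : H R ≤ 0) (K : ℝ → ℝ) (hK : Filter.Tendsto K (nhdsWithin 0 (Set.Ioi 0)) (nhds 0))
    (hHK : ∀ r ∈ Set.Ioo (0:ℝ) 1, - H r ≤ K r)
    (haR : ∀ r, R ≤ r → a r = 0) :
    ∫⁻ r in Set.Ioo (0:ℝ) 1, ENNReal.ofReal (a r) ≤ ∫⁻ r in Set.Ioo (0:ℝ) 1, ENNReal.ofReal (b r) := by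
  set I := ∫⁻ r in Set.Ioo (0:ℝ) 1, ENNReal.ofReal (b r) with hI
  have hsub : ∀ ε, 0 < ε → Set.Icc ε R ⊆ Set.Ioo (0:ℝ) 1 := fun ε hε x hx =>
    ⟨by linarith [hx.1], by linarith [hx.2]⟩
  have step : ∀ ε, 0 < ε → ε < R →
      ∫⁻ r in Set.Ioc ε R, ENNReal.ofReal (a r) ≤ I + ENNReal.ofReal (K ε) := by
    intro ε hε hεR
    have hac := ha.mono (hsub ε hε)
    have hbc := hb.mono (hsub ε hε)
    have hai : IntegrableOn a (Set.Icc ε R) := hac.integrableOn_Icc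
    have hbi : IntegrableOn b (Set.Icc ε R) := hbc.integrableOn_Icc
    have h := intervalIntegral.integral_le_sub_of_hasDeriv_right_of_le (g := H) (g' := H')
      (φ := fun r => a r - b r) hεR.le
      (fun x hx => (hH x (hsub ε hε hx)).continuousAt.continuousWithinAt)
      (fun x hx => (hH x (hsub ε hε (Set.Ioo_subset_Icc_self hx))).hasDerivWithinAt)
      (hai.sub hbi) (fun x hx => hle x (hsub ε hε (Set.Ioo_subset_Icc_self hx)))
    have hai' := hai.mono_set Set.Ioc_subset_Icc_self
    have hbi' := hbi.mono_set Set.Ioc_subset_Icc_self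
    rw [intervalIntegral.integral_of_le hεR.le, integral_sub hai' hbi'] at h
    have hKε := hHK ε ⟨hε, by linarith⟩
    have h2 : ∫ r in Set.Ioc ε R, a r ≤ (∫ r in Set.Ioc ε R, b r) + K ε := by linarith
    have hms : ∀ x ∈ Set.Ioc ε R, x ∈ Set.Ioo (0:ℝ) 1 := fun x hx =>
      hsub ε hε (Set.Ioc_subset_Icc_self hx)
    rw [← ofReal_integral_eq_lintegral_ofReal hai'
      (ae_restrict_of_forall_mem measurableSet_Ioc fun x hx => ha0 x (hms x hx))]
    refine (ENNReal.ofReal_le_ofReal h2).trans (ENNReal.ofReal_add_le.trans ?_)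
    gcongr
    rw [ofReal_integral_eq_lintegral_ofReal hbi'
      (ae_restrict_of_forall_mem measurableSet_Ioc fun x hx => hb0 x (hms x hx))]
    exact lintegral_mono_set hms
  have step2 : ∀ ε, 0 < ε → ∫⁻ r in Set.Ioc ε R, ENNReal.ofReal (a r) ≤ I := by
    intro ε hε
    have ht : Filter.Tendsto (fun e => I + ENNReal.ofReal (K e)) (nhdsWithin 0 (Set.Ioi 0))
        (nhds (I + ENNReal.ofReal 0)) :=
      tendsto_const_nhds.add (ENNReal.tendsto_ofReal hK)
    rw [ENNReal.ofReal_zero, add_zero] at ht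
    refine ge_of_tendsto ht ?_
    filter_upwards [Ioo_mem_nhdsGT (lt_min hε hR0)] with e he
    exact (lintegral_mono_set (Set.Ioc_subset_Ioc_left (he.2.le.trans (min_le_left _ _)))).trans
      (step e he.1 (he.2.trans_le (min_le_right _ _)))
  have hU : Set.Ioo (0:ℝ) 1 ⊆ (⋃ k : ℕ, Set.Ioc (1 / ((k:ℝ) + 1)) R) ∪ Set.Ici R := by
    intro x hx
    rcases le_or_gt R x with h | h
    · right; exact h
    · left
      obtain ⟨k, hk⟩ := exists_nat_one_div_lt hx.1
      exact Set.mem_iUnion.2 ⟨k, hk, h.le⟩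
  refine (lintegral_mono_set hU).trans ((lintegral_union_le _ _ _).trans ?_)
  have h0 : ∫⁻ r in Set.Ici R, ENNReal.ofReal (a r) = 0 := by
    rw [setLIntegral_congr_fun measurableSet_Ici (g := fun _ => 0) (fun x hx => by simp [haR x hx])]
    simp
  rw [h0, add_zero, setLIntegral_iUnion_of_directed]
  · exact iSup_le fun k => step2 _ (by positivity)
  · refine Monotone.directed_le (f := fun k : ℕ => Set.Ioc (1 / ((k:ℝ) + 1)) R) ?_
    intro i j hij
    exact Set.Ioc_subset_Ioc_left (Nat.one_div_le_one_div hij)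

lemma crr_oneD (p m : ℝ) (hp : 1 < p) (hm : 0 < m) (u v s : ℝ → ℝ)
    (hu : ∀ r ∈ Set.Ioo (0:ℝ) 1, HasDerivAt u (v r) r)
    (hv : ∀ r ∈ Set.Ioo (0:ℝ) 1, HasDerivAt v (s r) r)
    (hs : ContinuousOn s (Set.Ioo 0 1)) (M : ℝ) (hM : ∀ r, |v r| ≤ M)
    (R : ℝ) (hR0 : 0 < R) (hR1 : R < 1)
    (huR : ∀ r, R ≤ r → u r = 0) (hvR : v R = 0) :
    ∫⁻ r in Set.Ioo (0:ℝ) 1, ENNReal.ofReal (|u r| ^ p / Real.log (1 / r) ^ p / r) ≤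
    ∫⁻ r in Set.Ioo (0:ℝ) 1, ENNReal.ofReal
      ((p / ((p - 1) * m)) ^ p * (|s r + (m + 1) / r * v r| ^ p * r ^ (2 * p - 1))) := by
  have hp1 : 0 < p - 1 := by linarith
  have hp0 : 0 < p := by linarith
  have hL : ∀ r ∈ Set.Ioo (0:ℝ) 1, 0 < Real.log (1 / r) := fun r hr =>
    Real.log_pos (by rw [lt_div_iff₀ hr.1]; linarith [hr.2])
  have huc : ContinuousOn u (Set.Ioo 0 1) := fun r hr => (hu r hr).continuousAt.continuousWithinAt
  have hvc : ContinuousOn v (Set.Ioo 0 1) := fun r hr => (hv r hr).continuousAt.continuousWithinAt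
  have hLd : ∀ r ∈ Set.Ioo (0:ℝ) 1, HasDerivAt (fun r => Real.log (1 / r)) (-(1 / r)) r := by
    intro r hr
    have := (Real.hasDerivAt_log hr.1.ne').neg
    have e : (fun r : ℝ => Real.log (1 / r)) = -Real.log := by
      funext r; simp [Real.log_inv]
    rw [e, one_div]
    exact this
  have hLc : ContinuousOn (fun r => Real.log (1 / r)) (Set.Ioo 0 1) :=
    fun r hr => (hLd r hr).continuousAt.continuousWithinAt
  have hrne : ∀ r ∈ Set.Ioo (0:ℝ) 1, r ≠ 0 := fun r hr => hr.1.ne'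
  refine crr_oneD_abs _ _
    (fun r => p * (|u r| ^ p * (Real.log (1 / r) ^ (1 - p) / (p - 1)))
      + (p / (p - 1)) ^ p * (-(1 / m * (|v r| ^ p * r ^ p))))
    (fun r => p * ((p * |u r| ^ (p - 2) * u r * v r) * (Real.log (1 / r) ^ (1 - p) / (p - 1))
        + |u r| ^ p * (Real.log (1 / r) ^ (-p) / r))
      + (p / (p - 1)) ^ p * (-(1 / m * ((p * |v r| ^ (p - 2) * v r * s r) * r ^ p
        + |v r| ^ p * (p * r ^ (p - 1))))))
    R hR0 hR1 ?_ ?_ ?_ ?_ ?_ ?_ ?_ (fun r => (p / (p - 1)) ^ p * (1 / m * (M ^ p * r ^ p))) ?_ ?_ ?_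
  · refine ContinuousOn.div (ContinuousOn.div (huc.abs.rpow_const fun _ _ => Or.inr hp0.le)
      (hLc.rpow_const fun _ _ => Or.inr hp0.le) ?_) continuousOn_id hrne
    intro r hr
    exact (Real.rpow_pos_of_pos (hL r hr) p).ne'
  · refine continuousOn_const.mul (ContinuousOn.mul (ContinuousOn.rpow_const ?_
      fun _ _ => Or.inr hp0.le) (continuousOn_id.rpow_const fun r hr => Or.inl (hrne r hr)))
    exact (hs.add ((continuousOn_const.div continuousOn_id hrne).mul hvc)).abs
  · intro r hr
    have := hL r hr
    have := hr.1
    positivity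
  · intro r hr
    have := hr.1
    positivity
  · intro r hr
    have h1 := (hasDerivAt_abs_rpow (u r) hp).comp r (hu r hr)
    have h2 := (hasDerivAt_abs_rpow (v r) hp).comp r (hv r hr)
    have h3 := Real.hasDerivAt_rpow_const (x := r) (p := p) (Or.inl hr.1.ne')
    have h4 := ((hLd r hr).rpow_const (p := 1 - p) (Or.inl (hL r hr).ne')).div_const (p - 1)
    have h5 := ((h1.mul h4).const_mul p).add (((h2.mul h3).const_mul (1 / m)).neg.const_mul ((p / (p - 1)) ^ p))
    refine h5.congr_deriv ?_
    have : -(1 / r) * (1 - p) * Real.log (1 / r) ^ (1 - p - 1) / (p - 1) = Real.log (1 / r) ^ (-p) / r := by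
      rw [show 1 - p - 1 = -p by ring]
      have := hr.1
      field_simp
      ring
    rw [this]
    simp only [Function.comp_apply]
  · intro r hr
    have h1 := crr_part1 p r _ (u r) (v r) hp hr.1 (hL r hr)
    have h2 := crr_part2 p m r (v r) (s r) hp hm hr.1
    have h3 := mul_le_mul_of_nonneg_left h2 (by positivity : 0 ≤ (p / (p - 1)) ^ p)
    have h4 : (p / ((p - 1) * m)) ^ p = (p / (p - 1)) ^ p * (1 / m) ^ p := by
      rw [← Real.mul_rpow (by positivity) (by positivity)]; congr 1; field_simp
    rw [h4]
    linarith
  · simp [huR R le_rfl, hvR, Real.zero_rpow hp0.ne']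
  · have : Filter.Tendsto (fun r : ℝ => (p / (p - 1)) ^ p * (1 / m * (M ^ p * r ^ p))) (nhds 0)
        (nhds ((p / (p - 1)) ^ p * (1 / m * (M ^ p * 0 ^ p)))) :=
      (((Real.continuousAt_rpow_const 0 p (Or.inr hp0.le)).tendsto.const_mul _).const_mul _).const_mul _
    rw [Real.zero_rpow hp0.ne', mul_zero, mul_zero, mul_zero] at this
    exact this.mono_left nhdsWithin_le_nhds
  · intro r hr
    have := hL r hr
    have h0 := hr.1
    have h1 : 0 ≤ p * (|u r| ^ p * (Real.log (1 / r) ^ (1 - p) / (p - 1))) := by positivity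
    have h2 : (p / (p - 1)) ^ p * (1 / m * (|v r| ^ p * r ^ p)) ≤ (p / (p - 1)) ^ p * (1 / m * (M ^ p * r ^ p)) := by
      gcongr
      exact hM r
    linarith
  · intro r hr
    simp [huR r hr, Real.zero_rpow hp0.ne']

lemma crr_polar {E : Type*} [NormedAddCommGroup E] [NormedSpace ℝ E] [MeasurableSpace E]
    [BorelSpace E] [FiniteDimensional ℝ E] [Nontrivial E] (μ : Measure E) [μ.IsAddHaarMeasure]
    (n : ℕ) (hn : Module.finrank ℝ E = n) (F : E → ENNReal) (hF : Measurable F) :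
    ∫⁻ x in Metric.ball (0 : E) 1, F x ∂μ =
    ∫⁻ ω, (∫⁻ r in Set.Ioo (0:ℝ) 1, ENNReal.ofReal (r ^ (n - 1)) * F (r • (ω : E)))
      ∂μ.toSphere := by
  classical
  set G : E → ENNReal := (Metric.ball (0 : E) 1).indicator F with hG
  have hGm : Measurable G := hF.indicator measurableSet_ball
  rw [← lintegral_indicator measurableSet_ball, ← hG]
  have h1 : ∫⁻ x, G x ∂μ = ∫⁻ x : ({(0)}ᶜ : Set E), G x ∂(μ.comap (↑)) := by
    rw [lintegral_subtype_comap (measurableSet_singleton _).compl, restrict_compl_singleton]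
  have h2 := μ.measurePreserving_homeomorphUnitSphereProd.lintegral_comp_emb
    (Homeomorph.measurableEmbedding _) (fun z => G (z.2.1 • (z.1 : E)))
  have h3 : ∀ x : ({(0)}ᶜ : Set E), G (((homeomorphUnitSphereProd E x).2 : ℝ) • ((homeomorphUnitSphereProd E x).1 : E)) = G x := by
    intro x
    have : ‖(x : E)‖ ≠ 0 := norm_ne_zero_iff.2 x.2
    simp [smul_smul, this]
  simp only [h3] at h2
  rw [h1, h2, lintegral_prod]
  · refine lintegral_congr fun ω => ?_
    rw [Measure.volumeIoiPow, lintegral_withDensity_eq_lintegral_mul₀ (by fun_prop) (by fun_prop)]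
    rw [hn]
    simp only [Pi.mul_apply]
    rw [lintegral_subtype_comap measurableSet_Ioi
      (fun r : ℝ => ENNReal.ofReal (r ^ (n - 1)) * G (r • (ω : E)))]
    rw [← lintegral_indicator measurableSet_Ioi, ← lintegral_indicator measurableSet_Ioo]
    refine lintegral_congr fun r => ?_
    have hω : ‖(ω : E)‖ = 1 := by simp
    by_cases h0 : 0 < r
    · by_cases h1 : r < 1
      · rw [Set.indicator_of_mem (show r ∈ Set.Ioi (0:ℝ) from h0),
          Set.indicator_of_mem (show r ∈ Set.Ioo (0:ℝ) 1 from ⟨h0, h1⟩), hG, Set.indicator_of_mem]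
        simp [norm_smul, abs_of_pos h0, h1]
      · rw [Set.indicator_of_mem (show r ∈ Set.Ioi (0:ℝ) from h0),
          Set.indicator_of_notMem (show r ∉ Set.Ioo (0:ℝ) 1 from fun h => h1 h.2), hG,
          Set.indicator_of_notMem, mul_zero]
        simpa [norm_smul, abs_of_pos h0] using h1
    · rw [Set.indicator_of_notMem (show r ∉ Set.Ioi (0:ℝ) from h0),
          Set.indicator_of_notMem (show r ∉ Set.Ioo (0:ℝ) 1 from fun h => h0 h.1)]
  · fun_prop

lemma crr_ray_norm {n : ℕ} (ω : EuclideanSpace ℝ (Fin n)) (hω : ‖ω‖ = 1) (r : ℝ) (hr : 0 < r) :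
    ‖r • ω‖⁻¹ • (r • ω) = ω := by
  rw [norm_smul, hω, mul_one, Real.norm_of_nonneg hr.le, smul_smul, inv_mul_cancel₀ hr.ne', one_smul]

lemma crr_ray_deriv {n : ℕ} {G : Type*} [NormedAddCommGroup G] [NormedSpace ℝ G]
    (g : EuclideanSpace ℝ (Fin n) → G)
    (ω : EuclideanSpace ℝ (Fin n)) (r : ℝ) (hg : DifferentiableAt ℝ g (r • ω)) :
    HasDerivAt (fun t : ℝ => g (t • ω)) (fderiv ℝ g (r • ω) ω) r := by
  have h1 : HasDerivAt (fun t : ℝ => t • ω) ω r := by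
    simpa using (hasDerivAt_id r).smul_const ω
  exact hg.hasFDerivAt.comp_hasDerivAt r h1

lemma crr_radDeriv {n : ℕ} (f : EuclideanSpace ℝ (Fin n) → ℝ)
    (ω : EuclideanSpace ℝ (Fin n)) (hω : ‖ω‖ = 1) (r : ℝ) (hr : 0 < r) :
    radDeriv f (r • ω) = fderiv ℝ f (r • ω) ω := by
  rw [radDeriv, crr_ray_norm ω hω r hr]

lemma crr_radDeriv2 {n : ℕ} (f : EuclideanSpace ℝ (Fin n) → ℝ)
    (hf : Differentiable ℝ (fderiv ℝ f))
    (ω : EuclideanSpace ℝ (Fin n)) (hω : ‖ω‖ = 1) (r : ℝ) (hr : 0 < r) :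
    radDeriv (radDeriv f) (r • ω) = fderiv ℝ (fderiv ℝ f) (r • ω) ω ω := by
  rw [crr_radDeriv _ ω hω r hr]
  have hne : r • ω ≠ 0 := by
    intro h
    have := congrArg norm h
    rw [norm_smul, hω, norm_zero, Real.norm_of_nonneg hr.le] at this
    linarith
  have hd : DifferentiableAt ℝ (radDeriv f) (r • ω) := by
    have h1 : DifferentiableAt ℝ (fun x : EuclideanSpace ℝ (Fin n) => ‖x‖⁻¹ • x) (r • ω) :=
      ((differentiableAt_id.norm ℝ hne).inv (norm_ne_zero_iff.2 hne)).smul differentiableAt_id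
    exact (hf _).clm_apply h1
  have h1 := crr_ray_deriv (radDeriv f) ω r hd
  have h2 := (crr_ray_deriv (fderiv ℝ f) ω r (hf _)).clm_apply (hasDerivAt_const r ω)
  simp only [map_zero, add_zero] at h2
  refine h1.unique (h2.congr_of_eventuallyEq ?_)
  filter_upwards [lt_mem_nhds hr] with t ht
  exact crr_radDeriv f ω hω t ht

lemma crr_measurable_radDeriv {n : ℕ} (f : EuclideanSpace ℝ (Fin n) → ℝ) :
    Measurable (radDeriv f) := by
  have h1 : Measurable (fun x : EuclideanSpace ℝ (Fin n) => ‖x‖⁻¹ • x) := by fun_prop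
  have h2 := measurable_fderiv ℝ f
  have hc : Continuous (fun q : (EuclideanSpace ℝ (Fin n) →L[ℝ] ℝ) × EuclideanSpace ℝ (Fin n) =>
    q.1 q.2) := by fun_prop
  exact hc.measurable.comp (h2.prodMk h1)

lemma crr_bound {X G : Type*} [TopologicalSpace X] [Nonempty X] [NormedAddCommGroup G] (g : X → G)
    (hg : HasCompactSupport g) (hc : Continuous g) : ∃ M, 0 ≤ M ∧ ∀ x, ‖g x‖ ≤ M := by
  obtain ⟨M, hM⟩ := hg.exists_bound_of_continuous hc
  exact ⟨M, (norm_nonneg _).trans (hM (Classical.arbitrary X)), hM⟩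

lemma crr_bound_fderiv {X G : Type*} [NormedAddCommGroup X] [NormedSpace ℝ X]
    [NormedAddCommGroup G] [NormedSpace ℝ G] (g : X → G)
    (hg : ContDiff ℝ 1 g) (hc : HasCompactSupport g) : ∃ M, 0 ≤ M ∧ ∀ x, ‖fderiv ℝ g x‖ ≤ M :=
  crr_bound (fderiv ℝ g) (hc.fderiv ℝ) (hg.continuous_fderiv (by simp))

set_option maxHeartbeats 1000000 in
theorem critical_rellich_radial (n : ℕ) (hn : 3 ≤ n) (p : ℝ) (hp1 : 1 < p) (hpn : p < n)
    (f : EuclideanSpace ℝ (Fin n) → ℝ) (hf : ContDiff ℝ (⊤ : ℕ∞) f) (hfc : HasCompactSupport f)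
    (hsupp : tsupport f ⊆ Metric.ball (0 : EuclideanSpace ℝ (Fin n)) 1) :
    ∫ x in Metric.ball (0 : EuclideanSpace ℝ (Fin n)) 1,
        |f x| ^ p / (‖x‖ ^ (n : ℝ) * Real.log (1 / ‖x‖) ^ p) ≤
      (p / ((p - 1) * ((n : ℝ) - 2))) ^ p *
        ∫ x in Metric.ball (0 : EuclideanSpace ℝ (Fin n)) 1,
          |radLap f x| ^ p / ‖x‖ ^ ((n : ℝ) - 2 * p) := by
  have hn' : (3 : ℝ) ≤ n := by exact_mod_cast hn
  have hp0 : 0 < p := by linarith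
  have hpp : 0 < p - 1 := by linarith
  have hm : 0 < (n : ℝ) - 2 := by linarith
  have hfr : Module.finrank ℝ (EuclideanSpace ℝ (Fin n)) = n := by simp
  have hnt : Nontrivial (EuclideanSpace ℝ (Fin n)) := by
    apply Module.nontrivial_of_finrank_pos (R := ℝ); rw [hfr]; omega
  -- regularity
  have hf1 : ContDiff ℝ 1 (fderiv ℝ f) := hf.fderiv_right (by norm_cast)
  have hfd : Differentiable ℝ f := hf.differentiable (by simp)
  have hf1d : Differentiable ℝ (fderiv ℝ f) := hf1.differentiable (by simp)
  have hf2c : Continuous (fderiv ℝ (fderiv ℝ f)) := hf1.continuous_fderiv (by simp)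
  obtain ⟨M1, hM1', hM1⟩ := crr_bound_fderiv f (hf.of_le (by norm_cast)) hfc
  obtain ⟨M2, hM2', hM2⟩ := crr_bound_fderiv (fderiv ℝ f) hf1 (hfc.fderiv ℝ)
  obtain ⟨R', hR', hsR⟩ := exists_lt_subset_ball (isClosed_tsupport f) hsupp
  have hradm : Measurable (radLap f) := by
    have h1 := crr_measurable_radDeriv f
    have h2 := crr_measurable_radDeriv (radDeriv f)
    unfold radLap
    fun_prop
  have hfm : Measurable f := hf.continuous.measurable
  set C := (p / ((p - 1) * ((n : ℝ) - 2))) ^ p with hC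
  have hC0 : 0 ≤ C := by positivity
  set A : EuclideanSpace ℝ (Fin n) → ℝ :=
    fun x => |f x| ^ p / (‖x‖ ^ (n : ℝ) * Real.log (1 / ‖x‖) ^ p) with hA
  set B : EuclideanSpace ℝ (Fin n) → ℝ :=
    fun x => |radLap f x| ^ p / ‖x‖ ^ ((n : ℝ) - 2 * p) with hB
  have hAm : Measurable A := by rw [hA]; fun_prop
  have hBm : Measurable B := by rw [hB]; fun_prop
  have hA0 : ∀ x ∈ Metric.ball (0 : EuclideanSpace ℝ (Fin n)) 1, 0 ≤ A x := by
    intro x hx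
    rw [mem_ball_zero_iff] at hx
    have : 0 ≤ Real.log (1 / ‖x‖) := by
      rw [one_div, Real.log_inv, neg_nonneg]
      exact Real.log_nonpos (norm_nonneg _) hx.le
    rw [hA]; positivity
  have hB0 : ∀ x, 0 ≤ B x := by intro x; rw [hB]; positivity
  -- the estimate in `ℝ≥0∞`
  have key : ∫⁻ x in Metric.ball (0 : EuclideanSpace ℝ (Fin n)) 1, ENNReal.ofReal (A x) ≤
      ENNReal.ofReal C * ∫⁻ x in Metric.ball (0 : EuclideanSpace ℝ (Fin n)) 1, ENNReal.ofReal (B x) := by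
    rw [← lintegral_const_mul _ hBm.ennreal_ofReal,
      crr_polar _ n hfr _ hAm.ennreal_ofReal,
      crr_polar _ n hfr _ (hBm.ennreal_ofReal.const_mul _)]
    refine lintegral_mono fun ω => ?_
    have hω : ‖(ω : EuclideanSpace ℝ (Fin n))‖ = 1 := by simp
    obtain ⟨w, hw⟩ : ∃ w : EuclideanSpace ℝ (Fin n), w = ω := ⟨_, rfl⟩
    rw [← hw] at hω ⊢
    have hnw : ∀ r : ℝ, 0 < r → ‖r • w‖ = r := fun r hr => by
      rw [norm_smul, hω, mul_one, Real.norm_of_nonneg hr.le]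
    have hout : ∀ r : ℝ, max R' (1 / 2) ≤ r → r • w ∉ tsupport f := by
      intro r hr h
      have h0 : 0 < r := by linarith [le_max_right R' (1 / 2)]
      have := hsR h
      rw [mem_ball_zero_iff, hnw r h0] at this
      linarith [le_max_left R' (1 / 2)]
    have h := crr_oneD p ((n : ℝ) - 2) hp1 hm (fun r => f (r • w)) (fun r => fderiv ℝ f (r • w) w)
      (fun r => fderiv ℝ (fderiv ℝ f) (r • w) w w)
      (fun r _ => crr_ray_deriv f w r (hfd _))
      (fun r _ => by
        have h2 := (crr_ray_deriv (fderiv ℝ f) w r (hf1d _)).clm_apply (hasDerivAt_const r w)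
        simpa only [map_zero, add_zero] using h2)
      (Continuous.continuousOn (by fun_prop)) M1
      (fun r => by
        have := (fderiv ℝ f (r • w)).le_opNorm w
        rw [hω, mul_one] at this
        exact this.trans (hM1 _))
      (max R' (1 / 2)) (lt_max_of_lt_right (by norm_num)) (max_lt hR' (by norm_num))
      (fun r hr => image_eq_zero_of_notMem_tsupport (hout r hr))
      (by
        have : fderiv ℝ f ((max R' (1 / 2)) • w) = 0 := by
          by_contra h
          exact hout _ le_rfl (support_fderiv_subset ℝ h)
        rw [this]; rfl)
    refine le_trans (le_of_eq ?_) (h.trans (le_of_eq ?_))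
    · refine setLIntegral_congr_fun measurableSet_Ioo fun r hr => ?_
      have h0 : 0 < r := hr.1
      have hL : 0 < Real.log (1 / r) := Real.log_pos (by rw [lt_div_iff₀ hr.1]; linarith [hr.2])
      simp only [hA]
      rw [← ENNReal.ofReal_mul (by positivity), hnw r h0]
      congr 1
      have e : r ^ (n : ℝ) = r ^ (n - 1) * r := by
        rw [Real.rpow_natCast, ← pow_succ]; congr 1; omega
      rw [e]
      field_simp
    · refine setLIntegral_congr_fun measurableSet_Ioo fun r hr => ?_
      have h0 : 0 < r := hr.1
      simp only [hB]
      rw [← ENNReal.ofReal_mul hC0, ← ENNReal.ofReal_mul (by positivity), hnw r h0]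
      congr 1
      have e : r ^ (2 * p - 1) = r ^ (n - 1) / r ^ ((n : ℝ) - 2 * p) := by
        rw [← Real.rpow_natCast r (n - 1), ← Real.rpow_sub h0]
        congr 1
        rw [Nat.cast_sub (by omega)]; push_cast; ring
      have e2 : radLap f (r • w) = fderiv ℝ (fderiv ℝ f) (r • w) w w
          + ((n : ℝ) - 2 + 1) / r * fderiv ℝ f (r • w) w := by
        rw [radLap, crr_radDeriv2 f hf1d w hω r h0, crr_radDeriv f w hω r h0, hnw r h0]
        congr 3; ring
      rw [e, e2]
      ring
  -- integrability of the right-hand side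
  have hBi : IntegrableOn B (Metric.ball (0 : EuclideanSpace ℝ (Fin n)) 1) := by
    have hbig : IntegrableOn (fun x : EuclideanSpace ℝ (Fin n) =>
        (fun y : ℝ => (M2 + ((n : ℝ) - 1) * M1) ^ p * y ^ (p - n)) ‖x‖)
        (Metric.ball (0 : EuclideanSpace ℝ (Fin n)) 1) := by
      refine (integrableOn_fun_norm_addHaar volume
        (f := fun y : ℝ => (M2 + ((n : ℝ) - 1) * M1) ^ p * y ^ (p - n))).2 ?_
      rw [hfr]
      have h1 : IntegrableOn (fun y : ℝ => (M2 + ((n : ℝ) - 1) * M1) ^ p * y ^ (p - 1))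
          (Set.Ioo 0 1) :=
        ((intervalIntegral.integrableOn_Ioo_rpow_iff one_pos).2 (by linarith)).const_mul _
      refine h1.congr_fun (fun y hy => ?_) measurableSet_Ioo
      have e : y ^ (p - 1) = y ^ (n - 1) * y ^ (p - n) := by
        rw [← Real.rpow_natCast y (n - 1), ← Real.rpow_add hy.1]
        congr 1
        rw [Nat.cast_sub (by omega)]; push_cast; ring
      simp only [smul_eq_mul]
      rw [e]; ring
    refine Integrable.mono' hbig hBm.aestronglyMeasurable ?_
    have hne : ∀ᵐ x ∂((volume : Measure (EuclideanSpace ℝ (Fin n))).restrict (Metric.ball 0 1)),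
        x ≠ 0 := ae_restrict_of_ae (by
          rw [ae_iff]; simp)
    filter_upwards [hne, ae_restrict_mem measurableSet_ball] with x hx0 hx1
    rw [mem_ball_zero_iff] at hx1
    have hxp : 0 < ‖x‖ := norm_pos_iff.2 hx0
    rw [Real.norm_of_nonneg (hB0 x)]
    have hω : ‖‖x‖⁻¹ • x‖ = 1 := by
      rw [norm_smul, norm_inv, norm_norm, inv_mul_cancel₀ hxp.ne']
    obtain ⟨w, hw⟩ : ∃ w : EuclideanSpace ℝ (Fin n), w = ‖x‖⁻¹ • x := ⟨_, rfl⟩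
    rw [← hw] at hω
    have hxw : x = ‖x‖ • w := by rw [hw, smul_smul, mul_inv_cancel₀ hxp.ne', one_smul]
    have hbd : |radLap f x| ≤ (M2 + ((n : ℝ) - 1) * M1) / ‖x‖ := by
      have e1 : radDeriv f x = fderiv ℝ f x w := by
        have := crr_radDeriv f w hω ‖x‖ hxp
        rwa [← hxw] at this
      have e2 : radDeriv (radDeriv f) x = fderiv ℝ (fderiv ℝ f) x w w := by
        have := crr_radDeriv2 f hf1d w hω ‖x‖ hxp
        rwa [← hxw] at this
      have b1 : |fderiv ℝ f x w| ≤ M1 := by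
        have := (fderiv ℝ f x).le_opNorm w
        rw [hω, mul_one] at this
        exact this.trans (hM1 _)
      have b2 : |fderiv ℝ (fderiv ℝ f) x w w| ≤ M2 := by
        have := (fderiv ℝ (fderiv ℝ f) x).le_opNorm₂ w w
        rw [hω, mul_one, mul_one] at this
        exact this.trans (hM2 _)
      rw [radLap, e1, e2]
      refine (abs_add_le _ _).trans ?_
      have hn1 : 0 ≤ ((n : ℝ) - 1) := by linarith
      rw [abs_mul, abs_of_nonneg (a := ((n : ℝ) - 1) / ‖x‖) (by positivity), add_div]
      have c1 : M2 ≤ M2 / ‖x‖ := by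
        rw [le_div_iff₀ hxp]; nlinarith
      have c2 : ((n : ℝ) - 1) / ‖x‖ * |fderiv ℝ f x w| ≤ ((n : ℝ) - 1) * M1 / ‖x‖ := by
        rw [div_mul_eq_mul_div]; gcongr
      linarith
    have hK : 0 ≤ M2 + ((n : ℝ) - 1) * M1 := by
      have hn1 : 0 ≤ ((n : ℝ) - 1) := by linarith
      positivity
    simp only [hB]
    calc |radLap f x| ^ p / ‖x‖ ^ ((n : ℝ) - 2 * p)
        ≤ ((M2 + ((n : ℝ) - 1) * M1) / ‖x‖) ^ p / ‖x‖ ^ ((n : ℝ) - 2 * p) := by gcongr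
      _ = (M2 + ((n : ℝ) - 1) * M1) ^ p * ‖x‖ ^ (p - n) := by
        rw [Real.div_rpow hK hxp.le, div_div, ← Real.rpow_add hxp, div_eq_mul_inv,
          ← Real.rpow_neg hxp.le]
        congr 2; ring
  rw [integral_eq_lintegral_of_nonneg_ae (ae_restrict_of_forall_mem measurableSet_ball hA0)
    hAm.aestronglyMeasurable, integral_eq_lintegral_of_nonneg_ae (Filter.Eventually.of_forall hB0)
    hBm.aestronglyMeasurable]
  have hfin : ∫⁻ x in Metric.ball (0 : EuclideanSpace ℝ (Fin n)) 1, ENNReal.ofReal (B x) ≠ ⊤ := by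
    rw [← ofReal_integral_eq_lintegral_ofReal hBi (Filter.Eventually.of_forall hB0)]
    exact ENNReal.ofReal_ne_top
  have := ENNReal.toReal_mono (ENNReal.mul_ne_top ENNReal.ofReal_ne_top hfin) key
  rwa [ENNReal.toReal_mul, ENNReal.toReal_ofReal hC0] at this
end
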